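/- arXiv:1910.13424 — 2 statements merged into one kernel-verified Lean document; each statement's English description precedes it below -/
import Mathlib

section
/- Let 0 < m < 1/2 and let F₀ ∈ C²([0,∞)) be bounded with 0 ≤ F₀(x) ≤ m·x, satisfying (A1), (A2), and (A3). Let F be the function that is Lipschitz on [0,∞)×[0,∞), sublinear in x, satisfies 0 ≤ F(x,t) ≤ m·x, F(x,0) = F₀(x), and is a viscosity solution of (HJ) on (0,∞)×(0,∞). Then F belongs to C^{1,1}((0,∞)×(0,∞)) ∩ C¹([0,∞)×(0,∞)), and for all (x,t) ∈ (0,∞)×(0,∞): 0 ≤ ∂_x F(x,t) ≤ m, and −1 ≤ x·∂_x² F(x,t) ≤ 0 wherever the second derivative in x exists. -/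
open Set Filter

/-- A function `ψ : [0,∞) → ℝ` is sublinear if `ψ(x)/x → 0` as `x → ∞`. -/
def Sublinear (ψ : ℝ → ℝ) : Prop :=
  Tendsto (fun x => ψ x / x) atTop (nhds 0)

/-- `F` is sublinear in `x` if `x ↦ F(x,t)` is sublinear for each `t ≥ 0`. -/
def SublinearInX (F : ℝ → ℝ → ℝ) : Prop :=
  ∀ t, 0 ≤ t → Sublinear (fun x => F x t)

/-- Viscosity subsolution of
`∂ₜF + (1/2)(∂ₓF − m)(∂ₓF − m − 1) + F/x − m = 0` on `(0,∞) × (0,∞)`. -/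
def IsSubsolutionHJ (m : ℝ) (F : ℝ → ℝ → ℝ) : Prop :=
  ∀ φ : ℝ × ℝ → ℝ, ContDiff ℝ 1 φ →
    ∀ x₀ t₀ : ℝ, 0 < x₀ → 0 < t₀ →
      IsLocalMaxOn (fun p : ℝ × ℝ => F p.1 p.2 - φ p) (Ici 0 ×ˢ Ici 0) (x₀, t₀) →
      deriv (fun s => φ (x₀, s)) t₀ +
        (1 / 2) * (deriv (fun y => φ (y, t₀)) x₀ - m) *
          (deriv (fun y => φ (y, t₀)) x₀ - m - 1) +
        F x₀ t₀ / x₀ - m ≤ 0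

/-- Viscosity supersolution of
`∂ₜF + (1/2)(∂ₓF − m)(∂ₓF − m − 1) + F/x − m = 0` on `(0,∞) × (0,∞)`. -/
def IsSupersolutionHJ (m : ℝ) (F : ℝ → ℝ → ℝ) : Prop :=
  ∀ φ : ℝ × ℝ → ℝ, ContDiff ℝ 1 φ →
    ∀ x₀ t₀ : ℝ, 0 < x₀ → 0 < t₀ →
      IsLocalMinOn (fun p : ℝ × ℝ => F p.1 p.2 - φ p) (Ici 0 ×ˢ Ici 0) (x₀, t₀) →
      deriv (fun s => φ (x₀, s)) t₀ +
        (1 / 2) * (deriv (fun y => φ (y, t₀)) x₀ - m) *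
          (deriv (fun y => φ (y, t₀)) x₀ - m - 1) +
        F x₀ t₀ / x₀ - m ≥ 0

/-- Viscosity solution of (HJ). -/
def IsSolutionHJ (m : ℝ) (F : ℝ → ℝ → ℝ) : Prop :=
  IsSubsolutionHJ m F ∧ IsSupersolutionHJ m F

/-- A Lipschitz (on the quadrant), sublinear-in-`x` viscosity solution of (HJ)
with `0 ≤ F(x,t) ≤ m·x` and initial data `F₀`. -/
def GoodSolution (m : ℝ) (F₀ : ℝ → ℝ) (F : ℝ → ℝ → ℝ) : Prop :=
  (∃ K : NNReal, LipschitzOnWith K (fun p : ℝ × ℝ => F p.1 p.2) (Ici 0 ×ˢ Ici 0)) ∧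
  SublinearInX F ∧
  (∀ x t : ℝ, 0 ≤ x → 0 ≤ t → 0 ≤ F x t ∧ F x t ≤ m * x) ∧
  (∀ x : ℝ, 0 ≤ x → F x 0 = F₀ x) ∧
  IsSolutionHJ m F

/-- First derivative of `F₀` on `[0,∞)`. -/
noncomputable def D1 (F₀ : ℝ → ℝ) : ℝ → ℝ := derivWithin F₀ (Ici 0)

/-- Second derivative of `F₀` on `[0,∞)`. -/
noncomputable def D2 (F₀ : ℝ → ℝ) : ℝ → ℝ := derivWithin (derivWithin F₀ (Ici 0)) (Ici 0)

/-- The entire function `∑ wⁿ / (2n + j)!`. -/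
noncomputable def facSeries (j : ℕ) (w : ℝ) : ℝ := ∑' n : ℕ, w ^ n / ((2 * n + j).factorial : ℝ)

theorem norm_facSeries_term_le (j n : ℕ) (w : ℝ) :
    ‖w ^ n / ((2 * n + j).factorial : ℝ)‖ ≤ |w| ^ n / (n.factorial : ℝ) := by
  rw [norm_div, norm_pow, Real.norm_eq_abs, Real.norm_natCast]
  gcongr
  omega

theorem summable_facSeries (j : ℕ) (w : ℝ) :
    Summable fun n : ℕ => w ^ n / ((2 * n + j).factorial : ℝ) :=
  Summable.of_norm_bounded (Real.summable_pow_div_factorial |w|)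
    fun n => norm_facSeries_term_le j n w

theorem facSeries_eq (j : ℕ) (w : ℝ) :
    facSeries j w = 1 / (j.factorial : ℝ) + w * facSeries (j + 2) w := by
  unfold facSeries
  rw [(summable_facSeries j w).tsum_eq_zero_add, ← tsum_mul_left]
  congr 1
  · simp
  · refine tsum_congr fun n => ?_
    rw [show 2 * (n + 1) + j = 2 * n + (j + 2) by ring, pow_succ]
    ring

theorem facSeries_term_succ (j n : ℕ) (w : ℝ) :
    (((n + 1 : ℕ) : ℝ) * w ^ (n + 1 - 1)) / ((2 * (n + 1) + j).factorial : ℝ) =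
      (w ^ n / ((2 * n + (j + 1)).factorial : ℝ) -
        j * (w ^ n / ((2 * n + (j + 2)).factorial : ℝ))) / 2 := by
  have e1 : 2 * (n + 1) + j = (2 * n + (j + 1)) + 1 := by ring
  have e2 : 2 * n + (j + 2) = (2 * n + (j + 1)) + 1 := by ring
  have h0 : ((2 * n + (j + 1)).factorial : ℝ) ≠ 0 := by positivity
  rw [e1, e2, Nat.factorial_succ, Nat.add_sub_cancel]
  push_cast
  have h1 : (2 * (n : ℝ) + (j + 1) + 1) ≠ 0 := by positivity
  generalize ((2 * n + (j + 1)).factorial : ℝ) = f at *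
  generalize w ^ n = u
  field_simp
  ring

theorem hasDerivAt_facSeries (j : ℕ) (w : ℝ) :
    HasDerivAt (facSeries j) ((facSeries (j + 1) w - j * facSeries (j + 2) w) / 2) w := by
  have hw : w ∈ Metric.ball (0 : ℝ) (|w| + 1) := by simp
  have hu : Summable fun n : ℕ => (n : ℝ) * (|w| + 1) ^ (n - 1) / (n.factorial : ℝ) := by
    rw [← summable_nat_add_iff 1]
    refine (Real.summable_pow_div_factorial (|w| + 1)).congr fun n => ?_
    rw [Nat.factorial_succ, Nat.add_sub_cancel]
    push_cast
    have h1 : ((n : ℝ) + 1) ≠ 0 := by positivity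
    have h0 : (n.factorial : ℝ) ≠ 0 := by positivity
    field_simp
  have key : HasDerivAt (facSeries j)
      (∑' n : ℕ, (n * w ^ (n - 1)) / ((2 * n + j).factorial : ℝ)) w := by
    refine hasDerivAt_tsum_of_isPreconnected
      (g := fun (n : ℕ) (z : ℝ) => z ^ n / ((2 * n + j).factorial : ℝ))
      (g' := fun (n : ℕ) (z : ℝ) => (n * z ^ (n - 1)) / ((2 * n + j).factorial : ℝ))
      hu Metric.isOpen_ball (convex_ball 0 _).isPreconnected ?_ ?_ hw
      (summable_facSeries j w) hw
    · intro n z _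
      exact (hasDerivAt_pow n z).div_const ((2 * n + j).factorial : ℝ)
    · intro n z hz
      have hz' : |z| ≤ |w| + 1 := by
        have := Metric.mem_ball.1 hz
        rw [Real.dist_eq, sub_zero] at this
        exact this.le
      rw [norm_div, norm_mul, norm_pow, Real.norm_natCast, Real.norm_natCast, Real.norm_eq_abs]
      gcongr
      omega
  refine key.congr_deriv ?_
  have hs : Summable fun n : ℕ => (((n + 1 : ℕ) : ℝ) * w ^ (n + 1 - 1)) /
      ((2 * (n + 1) + j).factorial : ℝ) := by
    simp_rw [facSeries_term_succ]
    exact ((summable_facSeries (j + 1) w).sub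
      ((summable_facSeries (j + 2) w).mul_left _)).div_const 2
  rw [((summable_nat_add_iff
    (f := fun n : ℕ => ((n : ℝ) * w ^ (n - 1)) / ((2 * n + j).factorial : ℝ)) 1).1
    hs).tsum_eq_zero_add]
  simp_rw [facSeries_term_succ]
  rw [tsum_div_const, Summable.tsum_sub (summable_facSeries _ w)
    ((summable_facSeries _ w).mul_left _), tsum_mul_left]
  simp [facSeries]

theorem contDiff_facSeries (j : ℕ) : ContDiff ℝ 1 (facSeries j) := by
  rw [contDiff_one_iff_deriv]
  refine ⟨fun w => (hasDerivAt_facSeries j w).differentiableAt, ?_⟩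
  have : deriv (facSeries j) =
      fun w => (facSeries (j + 1) w - j * facSeries (j + 2) w) / 2 :=
    funext fun w => (hasDerivAt_facSeries j w).deriv
  rw [this]
  have hc : ∀ i, Continuous (facSeries i) := fun i =>
    continuous_iff_continuousAt.2 fun w => (hasDerivAt_facSeries i w).continuousAt
  exact ((hc _).sub (continuous_const.mul (hc _))).div_const 2

/-- `∑ lⁿ s^(2n+j) / (2n+j)!`, an iterated `s`-primitive of `cosh (√l s)`. -/
noncomputable def coshPrim (j : ℕ) (l s : ℝ) : ℝ := s ^ j * facSeries j (l * s ^ 2)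

theorem coshPrim_eq (j : ℕ) (l s : ℝ) :
    coshPrim j l s = s ^ j / (j.factorial : ℝ) + l * coshPrim (j + 2) l s := by
  unfold coshPrim
  rw [facSeries_eq j]
  ring

theorem hasDerivAt_coshPrim_succ (j : ℕ) (l s : ℝ) :
    HasDerivAt (coshPrim (j + 1) l) (coshPrim j l s) s := by
  have h := (hasDerivAt_pow (j + 1) s).mul
    ((hasDerivAt_facSeries (j + 1) (l * s ^ 2)).comp s ((hasDerivAt_pow 2 s).const_mul l))
  refine h.congr_deriv ?_
  have e1 := facSeries_eq j (l * s ^ 2)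
  have e2 := facSeries_eq (j + 1) (l * s ^ 2)
  have e3 : ((j + 1).factorial : ℝ) = (j + 1) * (j.factorial : ℝ) := by
    rw [Nat.factorial_succ]; push_cast; ring
  have h0 : (j.factorial : ℝ) ≠ 0 := by positivity
  have h1 : ((j : ℝ) + 1) ≠ 0 := by positivity
  have e4 : (j + 1 : ℝ) * (1 / ((j + 1).factorial : ℝ)) = 1 / (j.factorial : ℝ) := by
    rw [e3]; field_simp
  unfold coshPrim
  simp only [Function.comp_apply, Nat.add_sub_cancel]
  push_cast
  norm_num [pow_succ] at *
  linear_combination (j + 1 : ℝ) * s ^ j * e2 - s ^ j * e1 + s ^ j * e4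

theorem hasDerivAt_coshPrim_zero (l s : ℝ) :
    HasDerivAt (coshPrim 0 l) (l * coshPrim 1 l s) s := by
  have h := (hasDerivAt_pow 0 s).mul
    ((hasDerivAt_facSeries 0 (l * s ^ 2)).comp s ((hasDerivAt_pow 2 s).const_mul l))
  refine h.congr_deriv ?_
  unfold coshPrim
  simp
  ring

theorem hasDerivAt_coshPrim_left (j : ℕ) (l s : ℝ) :
    HasDerivAt (fun l => coshPrim j l s)
      ((s * coshPrim (j + 1) l s - j * coshPrim (j + 2) l s) / 2) l := by
  have h := ((hasDerivAt_facSeries j (l * s ^ 2)).comp l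
    ((hasDerivAt_id l).mul_const (s ^ 2))).const_mul (s ^ j)
  refine h.congr_deriv ?_
  unfold coshPrim
  ring

theorem contDiff_coshPrim (j : ℕ) : ContDiff ℝ 1 fun p : ℝ × ℝ => coshPrim j p.1 p.2 := by
  unfold coshPrim
  exact (contDiff_snd.pow j).mul ((contDiff_facSeries j).comp
    (contDiff_fst.mul (contDiff_snd.pow 2)))

theorem coshPrim_zero_zero (l : ℝ) : coshPrim 0 l 0 = 1 := by
  rw [coshPrim_eq]; simp [coshPrim]

theorem coshPrim_succ_zero (j : ℕ) (l : ℝ) : coshPrim (j + 1) l 0 = 0 := by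
  simp [coshPrim]

/-- Position along a characteristic, normalised by its starting point and by `1 - s / 2`. -/
noncomputable def charY (P v s : ℝ) : ℝ :=
  1 + P * coshPrim 1 (P ^ 2 + 2 * v) s + (P ^ 2 + v) * coshPrim 2 (P ^ 2 + 2 * v) s

/-- The `s`-derivative of `charY`. -/
noncomputable def charYd (P v s : ℝ) : ℝ :=
  P * coshPrim 0 (P ^ 2 + 2 * v) s + (P ^ 2 + v) * coshPrim 1 (P ^ 2 + 2 * v) s

/-- Time along a characteristic, normalised by its starting point. -/
noncomputable def charT (P v s : ℝ) : ℝ :=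
  s + P * coshPrim 2 (P ^ 2 + 2 * v) s + (P ^ 2 + v) * coshPrim 3 (P ^ 2 + 2 * v) s

/-- Variation of `ξ * charY` along a curve of initial data. -/
noncomputable def varY (P v g s : ℝ) : ℝ :=
  charY P v s + g * coshPrim 1 (P ^ 2 + 2 * v) s
    + (2 * P * g + (P - g) / 2 - v) * coshPrim 2 (P ^ 2 + 2 * v) s
    + (P * g + (P - g) / 2 - v) *
      (P * (s * coshPrim 2 (P ^ 2 + 2 * v) s - coshPrim 3 (P ^ 2 + 2 * v) s)
        + (P ^ 2 + v) * (s * coshPrim 3 (P ^ 2 + 2 * v) s - 2 * coshPrim 4 (P ^ 2 + 2 * v) s))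

/-- Variation of `ξ * charYd` along a curve of initial data. -/
noncomputable def varYd (P v g s : ℝ) : ℝ :=
  charYd P v s + g * coshPrim 0 (P ^ 2 + 2 * v) s
    + (2 * P * g + (P - g) / 2 - v) * coshPrim 1 (P ^ 2 + 2 * v) s
    + (P * g + (P - g) / 2 - v) *
      (P * (s * coshPrim 1 (P ^ 2 + 2 * v) s)
        + (P ^ 2 + v) * (s * coshPrim 2 (P ^ 2 + 2 * v) s - coshPrim 3 (P ^ 2 + 2 * v) s))

/-- Variation of `ξ * charT` along a curve of initial data. -/
noncomputable def varT (P v g s : ℝ) : ℝ :=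
  charT P v s + g * coshPrim 2 (P ^ 2 + 2 * v) s
    + (2 * P * g + (P - g) / 2 - v) * coshPrim 3 (P ^ 2 + 2 * v) s
    + (P * g + (P - g) / 2 - v) *
      (P * (s * coshPrim 3 (P ^ 2 + 2 * v) s - 2 * coshPrim 4 (P ^ 2 + 2 * v) s)
        + (P ^ 2 + v) * (s * coshPrim 4 (P ^ 2 + 2 * v) s - 3 * coshPrim 5 (P ^ 2 + 2 * v) s))

section derivatives

variable (P v g s : ℝ)

theorem hasDerivAt_charY : HasDerivAt (charY P v) (charYd P v s) s := by
  refine ((((hasDerivAt_coshPrim_succ 0 (P ^ 2 + 2 * v) s).const_mul P).const_add 1).add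
    ((hasDerivAt_coshPrim_succ 1 (P ^ 2 + 2 * v) s).const_mul (P ^ 2 + v))).congr_deriv ?_
  rfl

theorem hasDerivAt_charYd :
    HasDerivAt (charYd P v) ((P ^ 2 + 2 * v) * charY P v s - v) s := by
  refine (((hasDerivAt_coshPrim_zero (P ^ 2 + 2 * v) s).const_mul P).add
    ((hasDerivAt_coshPrim_succ 0 (P ^ 2 + 2 * v) s).const_mul (P ^ 2 + v))).congr_deriv ?_
  have h0 := coshPrim_eq 0 (P ^ 2 + 2 * v) s
  unfold charY
  norm_num at h0
  linear_combination (P ^ 2 + v) * h0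

theorem hasDerivAt_charT : HasDerivAt (charT P v) (charY P v s) s := by
  refine (((hasDerivAt_id s).add
    ((hasDerivAt_coshPrim_succ 1 (P ^ 2 + 2 * v) s).const_mul P)).add
    ((hasDerivAt_coshPrim_succ 2 (P ^ 2 + 2 * v) s).const_mul (P ^ 2 + v))).congr_deriv ?_
  rfl

theorem hasDerivAt_mul_coshPrim (j : ℕ) (l : ℝ) :
    HasDerivAt (fun s => s * coshPrim (j + 1) l s)
      (coshPrim (j + 1) l s + s * coshPrim j l s) s := by
  refine ((hasDerivAt_id s).mul (hasDerivAt_coshPrim_succ j l s)).congr_deriv ?_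
  simp

theorem hasDerivAt_varY : HasDerivAt (varY P v g) (varYd P v g s) s := by
  have h1 := hasDerivAt_coshPrim_succ 0 (P ^ 2 + 2 * v) s
  have h2 := hasDerivAt_coshPrim_succ 1 (P ^ 2 + 2 * v) s
  have h3 := hasDerivAt_coshPrim_succ 2 (P ^ 2 + 2 * v) s
  have h4 := hasDerivAt_coshPrim_succ 3 (P ^ 2 + 2 * v) s
  have k2 := hasDerivAt_mul_coshPrim s 1 (P ^ 2 + 2 * v)
  have k3 := hasDerivAt_mul_coshPrim s 2 (P ^ 2 + 2 * v)
  refine ((((hasDerivAt_charY P v s).add (h1.const_mul g)).add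
    (h2.const_mul (2 * P * g + (P - g) / 2 - v))).add
    ((((k2.sub h3).const_mul P).add ((k3.sub (h4.const_mul 2)).const_mul (P ^ 2 + v))).const_mul
      (P * g + (P - g) / 2 - v))).congr_deriv ?_
  unfold varYd
  simp only [Nat.reduceAdd]
  ring

theorem hasDerivAt_varT : HasDerivAt (varT P v g) (varY P v g s) s := by
  have h2 := hasDerivAt_coshPrim_succ 1 (P ^ 2 + 2 * v) s
  have h3 := hasDerivAt_coshPrim_succ 2 (P ^ 2 + 2 * v) s
  have h4 := hasDerivAt_coshPrim_succ 3 (P ^ 2 + 2 * v) s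
  have h5 := hasDerivAt_coshPrim_succ 4 (P ^ 2 + 2 * v) s
  have k3 := hasDerivAt_mul_coshPrim s 2 (P ^ 2 + 2 * v)
  have k4 := hasDerivAt_mul_coshPrim s 3 (P ^ 2 + 2 * v)
  refine ((((hasDerivAt_charT P v s).add (h2.const_mul g)).add
    (h3.const_mul (2 * P * g + (P - g) / 2 - v))).add
    ((((k3.sub (h4.const_mul 2)).const_mul P).add
      ((k4.sub (h5.const_mul 3)).const_mul (P ^ 2 + v))).const_mul
      (P * g + (P - g) / 2 - v))).congr_deriv ?_
  unfold varY
  simp only [Nat.reduceAdd]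
  ring

theorem hasDerivAt_varYd :
    HasDerivAt (varYd P v g) ((P ^ 2 + 2 * v) * varY P v g s
      + 2 * (P * g + (P - g) / 2 - v) * charY P v s - (P - g) / 2) s := by
  have h0 := hasDerivAt_coshPrim_zero (P ^ 2 + 2 * v) s
  have h1 := hasDerivAt_coshPrim_succ 0 (P ^ 2 + 2 * v) s
  have h3 := hasDerivAt_coshPrim_succ 2 (P ^ 2 + 2 * v) s
  have k1 := hasDerivAt_mul_coshPrim s 0 (P ^ 2 + 2 * v)
  have k2 := hasDerivAt_mul_coshPrim s 1 (P ^ 2 + 2 * v)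
  refine ((((hasDerivAt_charYd P v s).add (h0.const_mul g)).add
    (h1.const_mul (2 * P * g + (P - g) / 2 - v))).add
    (((k1.const_mul P).add ((k2.sub h3).const_mul (P ^ 2 + v))).const_mul
      (P * g + (P - g) / 2 - v))).congr_deriv ?_
  have e0 := coshPrim_eq 0 (P ^ 2 + 2 * v) s
  have e1 := coshPrim_eq 1 (P ^ 2 + 2 * v) s
  have e2 := coshPrim_eq 2 (P ^ 2 + 2 * v) s
  norm_num at e0 e1 e2
  unfold varY
  norm_num
  rw [show charY P v s = 1 + P * coshPrim 1 (P ^ 2 + 2 * v) s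
    + (P ^ 2 + v) * coshPrim 2 (P ^ 2 + 2 * v) s from rfl]
  linear_combination ((2 * P * g + (P - g) / 2 - v) + (P * g + (P - g) / 2 - v) * P * s) * e0
    + (P * g + (P - g) / 2 - v) * (-P + (P ^ 2 + v) * s) * e1
    + (P * g + (P - g) / 2 - v) * (-2 * (P ^ 2 + v)) * e2

theorem charY_zero : charY P v 0 = 1 := by
  simp [charY, coshPrim_succ_zero 0, coshPrim_succ_zero 1]

theorem charYd_zero : charYd P v 0 = P := by
  simp [charYd, coshPrim_succ_zero 0, coshPrim_zero_zero]

theorem charT_zero : charT P v 0 = 0 := by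
  simp [charT, coshPrim_succ_zero 1, coshPrim_succ_zero 2]

theorem varY_zero : varY P v g 0 = 1 := by
  simp [varY, charY_zero, coshPrim_succ_zero 0, coshPrim_succ_zero 1, coshPrim_succ_zero 2,
    coshPrim_succ_zero 3]

theorem varYd_zero : varYd P v g 0 = P + g := by
  simp [varYd, charYd_zero, coshPrim_zero_zero, coshPrim_succ_zero 0, coshPrim_succ_zero 1,
    coshPrim_succ_zero 2]

theorem varT_zero : varT P v g 0 = 0 := by
  simp [varT, charT_zero, coshPrim_succ_zero 1, coshPrim_succ_zero 2, coshPrim_succ_zero 3,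
    coshPrim_succ_zero 4]

end derivatives

section identities

variable (P v g : ℝ)

theorem eq_zero_of_hasDerivAt_zero {f : ℝ → ℝ} (h : ∀ s, HasDerivAt f 0 s) (h0 : f 0 = 0)
    (s : ℝ) : f s = 0 := by
  rw [is_const_of_deriv_eq_zero (fun s => (h s).differentiableAt) (fun s => (h s).deriv) s 0, h0]

theorem charYd_sq (s : ℝ) :
    charYd P v s ^ 2 = (P ^ 2 + 2 * v) * charY P v s ^ 2 - 2 * v * charY P v s := by
  have h := eq_zero_of_hasDerivAt_zero
    (f := fun s => charYd P v s ^ 2 - (P ^ 2 + 2 * v) * charY P v s ^ 2 + 2 * v * charY P v s)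
    (fun s => ?_) ?_ s
  · linear_combination h
  · have hy := hasDerivAt_charY P v s
    have hd := hasDerivAt_charYd P v s
    refine (((hd.pow 2).sub ((hy.pow 2).const_mul _)).add (hy.const_mul (2 * v))).congr_deriv ?_
    norm_num
    ring
  · simp only [charY_zero, charYd_zero]; ring

theorem charYd_mul_varYd (s : ℝ) :
    charYd P v s * varYd P v g s = (P ^ 2 + 2 * v) * charY P v s * varY P v g s
      + (P * g + (P - g) / 2 - v) * charY P v s ^ 2 - v * varY P v g s
      - (P - g) / 2 * charY P v s := by
  have h := eq_zero_of_hasDerivAt_zero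
    (f := fun s => charYd P v s * varYd P v g s - (P ^ 2 + 2 * v) * (charY P v s * varY P v g s)
      - (P * g + (P - g) / 2 - v) * charY P v s ^ 2 + v * varY P v g s
      + (P - g) / 2 * charY P v s)
    (fun s => ?_) ?_ s
  · linear_combination h
  · have hy := hasDerivAt_charY P v s
    have hd := hasDerivAt_charYd P v s
    have hr := hasDerivAt_varY P v g s
    have hrd := hasDerivAt_varYd P v g s
    refine (((((hd.mul hrd).sub ((hy.mul hr).const_mul _)).sub ((hy.pow 2).const_mul _)).add
      (hr.const_mul v)).add (hy.const_mul _)).congr_deriv ?_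
    norm_num
    ring
  · simp only [charY_zero, charYd_zero, varY_zero, varYd_zero]; ring

theorem varT_eq (s : ℝ) :
    2 * (P * g + (P - g) / 2 - v) * charT P v s + (P ^ 2 + 2 * v) * varT P v g s
      = varYd P v g s + (P - g) / 2 * s - (P + g) := by
  have h := eq_zero_of_hasDerivAt_zero
    (f := fun s => varYd P v g s + (P - g) / 2 * s - (P + g)
      - 2 * (P * g + (P - g) / 2 - v) * charT P v s - (P ^ 2 + 2 * v) * varT P v g s)
    (fun s => ?_) ?_ s
  · linear_combination -h
  · refine (((((hasDerivAt_varYd P v g s).add ((hasDerivAt_id s).const_mul ((P - g) / 2))).sub_const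
      (P + g)).sub ((hasDerivAt_charT P v s).const_mul _)).sub
      ((hasDerivAt_varT P v g s).const_mul (P ^ 2 + 2 * v))).congr_deriv ?_
    ring
  · simp [varYd_zero, charT_zero, varT_zero]

end identities

theorem le_of_hasDerivAt_nonneg {f f' : ℝ → ℝ} {a b : ℝ} (hab : a ≤ b)
    (hf : ∀ s ∈ Icc a b, HasDerivAt f (f' s) s) (h : ∀ s ∈ Icc a b, 0 ≤ f' s) : f a ≤ f b := by
  refine monotoneOn_of_deriv_nonneg (convex_Icc a b)
    (fun s hs => (hf s hs).continuousAt.continuousWithinAt)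
    (fun s hs => (hf s (interior_subset hs)).differentiableAt.differentiableWithinAt)
    (fun s hs => ?_) (left_mem_Icc.2 hab) (right_mem_Icc.2 hab) hab
  rw [(hf s (interior_subset hs)).deriv]
  exact h s (interior_subset hs)

theorem nonneg_of_forall_Ico {f : ℝ → ℝ} {a c : ℝ} (hac : a < c) (hf : Continuous f)
    (h : ∀ s ∈ Ico a c, 0 ≤ f s) : 0 ≤ f c := by
  have : Icc a c ⊆ f ⁻¹' Ici 0 := by
    rw [← closure_Ico hac.ne]
    exact closure_minimal h (isClosed_Ici.preimage hf)
  exact this (right_mem_Icc.2 hac.le)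

theorem pos_of_forall_Ico_pos {f : ℝ → ℝ} {a b : ℝ} (hf : Continuous f)
    (h : ∀ c, a ≤ c → c < b → (∀ s ∈ Ico a c, 0 < f s) → 0 < f c) {s : ℝ} (hs : a ≤ s)
    (hsb : s < b) : 0 < f s := by
  by_contra hneg
  have hne : (Icc a s ∩ f ⁻¹' Iic 0).Nonempty := ⟨s, right_mem_Icc.2 hs, not_lt.1 hneg⟩
  have hcpt : IsCompact (Icc a s ∩ f ⁻¹' Iic 0) :=
    isCompact_Icc.inter_right (isClosed_Iic.preimage hf)
  obtain ⟨c, ⟨hc, hc0⟩, hmin⟩ := hcpt.exists_isLeast hne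
  refine absurd (h c hc.1 (hc.2.trans_lt hsb) fun r hr => ?_) (not_lt.2 hc0)
  by_contra hr0
  exact absurd (hmin ⟨⟨hr.1, hr.2.le.trans hc.2⟩, not_lt.1 hr0⟩) (not_le.2 hr.2)

theorem continuous_charY (P v : ℝ) : Continuous (charY P v) :=
  continuous_iff_continuousAt.2 fun s => (hasDerivAt_charY P v s).continuousAt

theorem continuous_charYd (P v : ℝ) : Continuous (charYd P v) :=
  continuous_iff_continuousAt.2 fun s => (hasDerivAt_charYd P v s).continuousAt

theorem hasDerivAt_one_sub_half (s : ℝ) : HasDerivAt (fun s : ℝ => 1 - s / 2) (-(1 / 2)) s :=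
  ((hasDerivAt_id s).div_const 2).const_sub 1

/-- Admissible initial slopes and heights for a characteristic. -/
structure Admissible (P v : ℝ) : Prop where
  gt : -(1 / 2) < P
  le : P ≤ 0
  dev : 0 ≤ v - P / 2
  energy : P ^ 2 + 2 * v ≤ -P

section bounds

variable {P v : ℝ}

theorem hasDerivAt_slope {s : ℝ} (hY : charY P v s ≠ 0) :
    HasDerivAt (fun s => charYd P v s / charY P v s) (v / charY P v s) s := by
  refine ((hasDerivAt_charYd P v s).div (hasDerivAt_charY P v s) hY).congr_deriv ?_
  have := charYd_sq P v s
  field_simp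
  linear_combination -this

theorem charYd_le_of_pos (h : Admissible P v) {s : ℝ} (hs : 0 ≤ s)
    (hY : ∀ r ∈ Icc 0 s, 0 < charY P v r) :
    charYd P v s / charY P v s ≤ P * (1 - s / 2) := by
  have key := le_of_hasDerivAt_nonneg (a := 0) (b := s)
    (f := fun s => P * (1 - s / 2) - charYd P v s / charY P v s) hs
    (fun r hr => ((hasDerivAt_one_sub_half r).const_mul P).sub (hasDerivAt_slope (hY r hr).ne'))
    (fun r hr => ?_)
  · simp only [charY_zero, charYd_zero] at key
    linarith
  · have h1 := hY r hr
    have h2 : (charYd P v r / charY P v r) ^ 2 = P ^ 2 + 2 * v - 2 * (v / charY P v r) := by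
      have := charYd_sq P v r
      field_simp
      linear_combination this
    nlinarith [sq_nonneg (charYd P v r / charY P v r), h.energy]

theorem charYd_nonpos_of_pos (h : Admissible P v) {s : ℝ} (hs : 0 ≤ s) (hs2 : s < 2)
    (hY : ∀ r ∈ Icc 0 s, 0 < charY P v r) : charYd P v s ≤ 0 := by
  have h1 := charYd_le_of_pos h hs hY
  rw [div_le_iff₀ (hY s (right_mem_Icc.2 hs))] at h1
  nlinarith [mul_nonneg (mul_nonneg (neg_nonneg.2 h.le) (by linarith : 0 ≤ 1 - s / 2))
    (hY s (right_mem_Icc.2 hs)).le]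

theorem dev_nonneg_of_pos (h : Admissible P v) {s : ℝ} (hs : 0 ≤ s) (hs2 : s < 2)
    (hY : ∀ r ∈ Icc 0 s, 0 < charY P v r ∧ 0 < (1 - r / 2) * charYd P v r + charY P v r) :
    0 ≤ v * (1 - s / 2) - charYd P v s / 2 := by
  have key := le_of_hasDerivAt_nonneg (a := 0) (b := s)
    (f := fun s => (v * (1 - s / 2) - charYd P v s / 2) / (1 - s / 2) ^ 2)
    (f' := fun s => -charYd P v s * ((1 - s / 2) * charYd P v s + charY P v s)
      / (2 * charY P v s * (1 - s / 2) ^ 3)) hs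
    (fun r hr => ?_) (fun r hr => ?_)
  · simp only [charYd_zero] at key
    have h1 := h.dev
    have h2 : 0 < (1 - s / 2) ^ 2 := pow_pos (by linarith) 2
    have : 0 ≤ (v * (1 - s / 2) - charYd P v s / 2) / (1 - s / 2) ^ 2 := by
      refine le_trans ?_ key
      norm_num
      linarith
    exact (div_nonneg_iff.1 this).elim (fun h => h.1) fun h => absurd h.2 (not_le.2 h2)
  · have h1 : (1 - r / 2) ≠ 0 := by have := hr.2; intro h; linarith
    have h2 := (hY r hr).1.ne'
    refine ((((hasDerivAt_one_sub_half r).const_mul v).sub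
      ((hasDerivAt_charYd P v r).div_const 2)).div ((hasDerivAt_one_sub_half r).pow 2)
      (pow_ne_zero 2 h1)).congr_deriv ?_
    have := charYd_sq P v r
    simp only [Pi.pow_apply, Pi.sub_apply]
    generalize 1 - r / 2 = σ at *
    field_simp
    linear_combination (2 * σ ^ 2) * this
  · have h1 : 0 < 1 - r / 2 := by have := hr.2; linarith
    have h2 := charYd_nonpos_of_pos h hr.1 (hr.2.trans_lt hs2) fun q hq =>
      (hY q ⟨hq.1, hq.2.trans hr.2⟩).1
    obtain ⟨h3, h4⟩ := hY r hr
    have : 0 ≤ -charYd P v r := by linarith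
    positivity

theorem le_slope_of_pos (h : Admissible P v) {s : ℝ} (hs : 0 ≤ s) (hs2 : s < 2)
    (hY : ∀ r ∈ Icc 0 s, 0 < charY P v r ∧ 0 < (1 - r / 2) * charYd P v r + charY P v r) :
    P ≤ (1 - s / 2) * (charYd P v s / charY P v s) := by
  have key := le_of_hasDerivAt_nonneg (a := 0) (b := s)
    (f := fun s => (1 - s / 2) * (charYd P v s / charY P v s))
    (f' := fun s => (v * (1 - s / 2) - charYd P v s / 2) / charY P v s) hs
    (fun r hr => ?_) (fun r hr => ?_)
  · simpa [charY_zero, charYd_zero] using key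
  · have h2 := (hY r hr).1.ne'
    refine ((hasDerivAt_one_sub_half r).mul (hasDerivAt_slope h2)).congr_deriv ?_
    field_simp
    ring
  · exact div_nonneg (dev_nonneg_of_pos h hr.1 (hr.2.trans_lt hs2) fun q hq =>
      hY q ⟨hq.1, hq.2.trans hr.2⟩) (hY r hr).1.le

theorem sub_le_charY_of_pos (h : Admissible P v) {s : ℝ} (hs : 0 ≤ s) (hs2 : s < 2)
    (hY : ∀ r ∈ Icc 0 s, 0 < charY P v r ∧ 0 < (1 - r / 2) * charYd P v r + charY P v r) :
    1 - s / 2 ≤ charY P v s := by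
  have key := le_of_hasDerivAt_nonneg (a := 0) (b := s)
    (f := fun s => charY P v s / (1 - s / 2))
    (f' := fun s => ((1 - s / 2) * charYd P v s + charY P v s / 2) / (1 - s / 2) ^ 2) hs
    (fun r hr => ?_) (fun r hr => ?_)
  · simp only [charY_zero] at key
    rw [le_div_iff₀ (by linarith)] at key
    linarith
  · have h1 : (1 - r / 2) ≠ 0 := by have := hr.2; intro h; linarith
    refine ((hasDerivAt_charY P v r).div (hasDerivAt_one_sub_half r) h1).congr_deriv ?_
    ring
  · have h1 := le_slope_of_pos h hr.1 (hr.2.trans_lt hs2) fun q hq =>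
      hY q ⟨hq.1, hq.2.trans hr.2⟩
    have h2 := (hY r hr).1
    rw [← mul_div_assoc, le_div_iff₀ h2] at h1
    have := h.gt
    have : 0 ≤ (1 - r / 2) * charYd P v r + charY P v r / 2 := by nlinarith
    positivity

theorem charY_pos_and (h : Admissible P v) {s : ℝ} (hs : 0 ≤ s) (hs2 : s < 2) :
    0 < charY P v s ∧ 0 < (1 - s / 2) * charYd P v s + charY P v s := by
  rw [← lt_min_iff]
  have hσ : Continuous fun s : ℝ => 1 - s / 2 := by fun_prop
  refine pos_of_forall_Ico_pos (a := 0) (b := 2)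
    (f := fun s => min (charY P v s) ((1 - s / 2) * charYd P v s + charY P v s))
    ((continuous_charY P v).min ((hσ.mul (continuous_charYd P v)).add (continuous_charY P v)))
    (fun c hc hc2 hpos => ?_) hs hs2
  simp only [lt_min_iff] at hpos ⊢
  rcases hc.eq_or_lt with rfl | hc0
  · simp only [charY_zero, charYd_zero]
    exact ⟨one_pos, by linarith [h.gt]⟩
  · have h1 : 0 ≤ charY P v c - (1 - c / 2) :=
      nonneg_of_forall_Ico (f := fun c => charY P v c - (1 - c / 2)) hc0
        ((continuous_charY P v).sub hσ) fun s hs => sub_nonneg.2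
        (sub_le_charY_of_pos h hs.1 (hs.2.trans hc2) fun r hr => hpos r ⟨hr.1, hr.2.trans_lt hs.2⟩)
    have h2 : 0 ≤ (1 - c / 2) * charYd P v c - P * charY P v c := by
      refine nonneg_of_forall_Ico (f := fun c => (1 - c / 2) * charYd P v c - P * charY P v c) hc0
        ((hσ.mul (continuous_charYd P v)).sub ((continuous_charY P v).const_mul P)) fun s hs => ?_
      have h3 := le_slope_of_pos h hs.1 (hs.2.trans hc2) fun r hr =>
        hpos r ⟨hr.1, hr.2.trans_lt hs.2⟩
      rw [← mul_div_assoc, le_div_iff₀ (hpos s hs).1] at h3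
      linarith
    have h3 : 0 < charY P v c := by linarith
    exact ⟨h3, by nlinarith [h.gt]⟩

end bounds

namespace Admissible

variable {P v s : ℝ}

theorem charY_pos (h : Admissible P v) (hs : 0 ≤ s) (hs2 : s < 2) : 0 < charY P v s :=
  (charY_pos_and h hs hs2).1

theorem sub_le_charY (h : Admissible P v) (hs : 0 ≤ s) (hs2 : s < 2) :
    1 - s / 2 ≤ charY P v s :=
  sub_le_charY_of_pos h hs hs2 fun _ hr => charY_pos_and h hr.1 (hr.2.trans_lt hs2)

theorem charYd_nonpos (h : Admissible P v) (hs : 0 ≤ s) (hs2 : s < 2) : charYd P v s ≤ 0 :=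
  charYd_nonpos_of_pos h hs hs2 fun _ hr => h.charY_pos hr.1 (hr.2.trans_lt hs2)

theorem slope_le (h : Admissible P v) (hs : 0 ≤ s) (hs2 : s < 2) :
    charYd P v s / charY P v s ≤ P * (1 - s / 2) :=
  charYd_le_of_pos h hs fun _ hr => h.charY_pos hr.1 (hr.2.trans_lt hs2)

theorem le_slope (h : Admissible P v) (hs : 0 ≤ s) (hs2 : s < 2) :
    P ≤ (1 - s / 2) * (charYd P v s / charY P v s) :=
  le_slope_of_pos h hs hs2 fun _ hr => charY_pos_and h hr.1 (hr.2.trans_lt hs2)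

theorem dev_nonneg (h : Admissible P v) (hs : 0 ≤ s) (hs2 : s < 2) :
    0 ≤ v * (1 - s / 2) - charYd P v s / 2 :=
  dev_nonneg_of_pos h hs hs2 fun _ hr => charY_pos_and h hr.1 (hr.2.trans_lt hs2)

theorem slope_nonpos (h : Admissible P v) (hs : 0 ≤ s) (hs2 : s < 2) :
    (1 - s / 2) * (charYd P v s / charY P v s) ≤ 0 :=
  mul_nonpos_of_nonneg_of_nonpos (by linarith)
    (div_nonpos_of_nonpos_of_nonneg (h.charYd_nonpos hs hs2) (h.charY_pos hs hs2).le)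

theorem charY_le_one (h : Admissible P v) (hs : 0 ≤ s) (hs2 : s < 2) : charY P v s ≤ 1 := by
  have key := le_of_hasDerivAt_nonneg (f := fun s => -charY P v s) hs
    (fun r _ => (hasDerivAt_charY P v r).neg)
    fun r hr => neg_nonneg.2 (h.charYd_nonpos hr.1 (hr.2.trans_lt hs2))
  simp only [charY_zero] at key
  linarith

theorem neg_quarter_lt (h : Admissible P v) : -(1 / 4) < v := by
  linarith [h.dev, h.gt]

theorem abs_energy_le (h : Admissible P v) : |P ^ 2 + 2 * v| ≤ 1 / 2 := by
  rw [abs_le]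
  constructor <;> nlinarith [h.energy, h.gt, h.dev, sq_nonneg P]

theorem slope_sq (h : Admissible P v) (hs : 0 ≤ s) (hs2 : s < 2) :
    (charYd P v s / charY P v s) ^ 2 = P ^ 2 + 2 * v - 2 * (v / charY P v s) := by
  have h1 := (h.charY_pos hs hs2).ne'
  have := charYd_sq P v s
  field_simp
  linear_combination this

theorem height_nonpos (h : Admissible P v) (hs : 0 ≤ s) (hs2 : s < 2) :
    v * (1 - s / 2) ^ 2 / charY P v s + (1 - s / 2) * (charYd P v s / charY P v s) / 2 ≤ 0 := by
  have h1 := h.slope_sq hs hs2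
  have h2 := h.slope_le hs hs2
  have h3 := h.energy
  rw [mul_div_right_comm]
  generalize v / charY P v s = a at *
  generalize charYd P v s / charY P v s = Q at *
  have h4 : 0 < 1 - s / 2 := by linarith
  generalize 1 - s / 2 = σ at *
  nlinarith [sq_nonneg (σ * Q), mul_nonneg h4.le (sub_nonneg.2 h2),
    mul_nonneg (sq_nonneg σ) (sub_nonneg.2 h3)]

theorem slope_le_height (h : Admissible P v) (hs : 0 ≤ s) (hs2 : s < 2) :
    (1 - s / 2) * (charYd P v s / charY P v s) ≤
      v * (1 - s / 2) ^ 2 / charY P v s + (1 - s / 2) * (charYd P v s / charY P v s) / 2 := by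
  have h1 := h.charY_pos hs hs2
  have h2 := h.dev_nonneg hs hs2
  have h4 : 0 < 1 - s / 2 := by linarith
  have : 0 ≤ (1 - s / 2) * (v * (1 - s / 2) - charYd P v s / 2) / charY P v s := by positivity
  refine le_of_sub_nonneg (this.trans_eq ?_)
  field_simp
  ring

theorem rpow_le_charY (h : Admissible P v) (hs : 0 ≤ s) (hs2 : s < 2) :
    (1 - s / 2) ^ (-2 * P) ≤ charY P v s := by
  have key := le_of_hasDerivAt_nonneg (f := fun s => charY P v s * (1 - s / 2) ^ (2 * P))
    (f' := fun s => ((1 - s / 2) * (charYd P v s / charY P v s) - P)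
      * (charY P v s * (1 - s / 2) ^ (2 * P - 1))) hs
    (fun r hr => ?_) fun r hr => ?_
  · simp only [charY_zero, zero_div, sub_zero, Real.one_rpow, mul_one] at key
    have h4 : 0 < 1 - s / 2 := by linarith
    rw [neg_mul, Real.rpow_neg h4.le]
    exact inv_le_of_inv_le₀ (h.charY_pos hs hs2) (by
      rw [inv_le_iff_one_le_mul₀ (h.charY_pos hs hs2)]; linarith)
  · have h4 : 0 < 1 - r / 2 := by linarith [hr.2]
    have h5 := (h.charY_pos hr.1 (hr.2.trans_lt hs2)).ne'
    refine ((hasDerivAt_charY P v r).mul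
      ((hasDerivAt_one_sub_half r).rpow_const (p := 2 * P) (Or.inl h4.ne'))).congr_deriv ?_
    rw [Real.rpow_sub_one h4.ne']
    generalize (1 - r / 2) ^ (2 * P) = X
    generalize 1 - r / 2 = σ at h4
    field_simp
    ring
  · have h4 : 0 < 1 - r / 2 := by linarith [hr.2]
    exact mul_nonneg (sub_nonneg.2 (h.le_slope hr.1 (hr.2.trans_lt hs2)))
      (mul_nonneg (h.charY_pos hr.1 (hr.2.trans_lt hs2)).le (Real.rpow_nonneg h4.le _))

theorem neg_rpow_le_slope (h : Admissible P v) (hs : 0 ≤ s) (hs2 : s < 2) :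
    -(1 - s / 2) ^ (1 + 2 * P) ≤ (1 - s / 2) * (charYd P v s / charY P v s) := by
  have h1 := h.charY_pos hs hs2
  have h2 := h.charY_le_one hs hs2
  have h4 : 0 < 1 - s / 2 := by linarith
  have hd : -1 ≤ charYd P v s := by
    have h5 := charYd_sq P v s
    have h6 := (abs_le.1 h.abs_energy_le).2
    have h7 := h.neg_quarter_lt
    nlinarith [mul_nonneg (sq_nonneg (charY P v s)) (sub_nonneg.2 h6),
      mul_nonneg h1.le (sub_nonneg.2 h7.le)]
  have h8 := h.rpow_le_charY hs hs2
  have h9 : 0 < (1 - s / 2) ^ (-2 * P) := Real.rpow_pos_of_pos h4 _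
  rw [← mul_div_assoc, le_div_iff₀ h1, Real.rpow_add h4, Real.rpow_one]
  have h10 : (1 - s / 2) ^ (2 * P) * (1 - s / 2) ^ (-2 * P) = 1 := by
    rw [← Real.rpow_add h4]; simp
  have h11 : 1 ≤ (1 - s / 2) ^ (2 * P) * charY P v s := by
    exact h10.symm.trans_le (mul_le_mul_of_nonneg_left h8 (Real.rpow_nonneg h4.le _))
  nlinarith

end Admissible

section variation

variable (P v g : ℝ)

/-- Jacobian of the characteristic flow, up to the factor `ξ * charY`. -/
noncomputable def jac (s : ℝ) : ℝ :=
  (1 - s / 2) * varY P v g s + (1 / 2 - (1 - s / 2) * (charYd P v s / charY P v s)) * varT P v g s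

/-- Variation of the slope at fixed time, up to a factor; also the derivative of `jac`. -/
noncomputable def jacDeriv (s : ℝ) : ℝ :=
  (1 - s / 2) * (g + (P * g + (P - g) / 2 - v) * charT P v s)
    - (v * (1 - s / 2) - charYd P v s / 2) / charY P v s * varT P v g s

variable {P v g} {s : ℝ}

theorem varYd_sub (h : Admissible P v) (hs : 0 ≤ s) (hs2 : s < 2) :
    varYd P v g s - charYd P v s / charY P v s * varY P v g s =
      g + (P * g + (P - g) / 2 - v) * charT P v s := by
  have hY : ∀ r ∈ Icc 0 s, charY P v r ≠ 0 := fun r hr =>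
    (h.charY_pos hr.1 (hr.2.trans_lt hs2)).ne'
  have hder : ∀ r ∈ Icc 0 s, HasDerivAt (fun s => (charY P v s * varYd P v g s
      - charYd P v s * varY P v g s
      - charY P v s * (g + (P * g + (P - g) / 2 - v) * charT P v s)) / charY P v s) 0 r := by
    intro r hr
    have hy := hasDerivAt_charY P v r
    refine ((((hy.mul (hasDerivAt_varYd P v g r)).sub
      ((hasDerivAt_charYd P v r).mul (hasDerivAt_varY P v g r))).sub
      (hy.mul (((hasDerivAt_charT P v r).const_mul _).const_add g))).div hy
      (hY r hr)).congr_deriv ?_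
    have e1 := charYd_sq P v r
    have e2 := charYd_mul_varYd P v g r
    simp only [Pi.mul_apply, Pi.sub_apply]
    rw [div_eq_zero_iff]
    left
    linear_combination (-charY P v r) * e2 + varY P v g r * e1
  have key := constant_of_has_deriv_right_zero
    (fun r hr => (hder r hr).continuousAt.continuousWithinAt)
    (fun r hr => (hder r (Ico_subset_Icc_self hr)).hasDerivWithinAt) s (right_mem_Icc.2 hs)
  simp only [charY_zero, charYd_zero, varY_zero, varYd_zero, charT_zero] at key
  have h0 := hY s (right_mem_Icc.2 hs)
  have : (1 * (P + g) - P * 1 - 1 * (g + (P * g + (P - g) / 2 - v) * 0)) / 1 = 0 := by ring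
  rw [this, div_eq_zero_iff] at key
  have key := key.resolve_right h0
  field_simp
  linear_combination 2 * key

theorem hasDerivAt_jac (h : Admissible P v) (hs : 0 ≤ s) (hs2 : s < 2) :
    HasDerivAt (jac P v g) (jacDeriv P v g s) s := by
  have h0 := (h.charY_pos hs hs2).ne'
  refine (((hasDerivAt_one_sub_half s).mul (hasDerivAt_varY P v g s)).add
    ((((hasDerivAt_one_sub_half s).mul (hasDerivAt_slope h0)).const_sub (1 / 2)).mul
      (hasDerivAt_varT P v g s))).congr_deriv ?_
  have e := varYd_sub (g := g) h hs hs2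
  simp only [Pi.mul_apply]
  rw [jacDeriv, ← e]
  ring

theorem hasDerivAt_jacDeriv (h : Admissible P v) (hs : 0 ≤ s) (hs2 : s < 2) :
    HasDerivAt (jacDeriv P v g)
      ((((1 - s / 2) * (charYd P v s / charY P v s) - 1) * jacDeriv P v g s
        - 2 * ((v * (1 - s / 2) - charYd P v s / 2) / charY P v s) * jac P v g s)
        / (1 - s / 2)) s := by
  have h0 := (h.charY_pos hs hs2).ne'
  have h4 : (1 - s / 2) ≠ 0 := by intro h; linarith
  refine (((hasDerivAt_one_sub_half s).mul
    (((hasDerivAt_charT P v s).const_mul (P * g + (P - g) / 2 - v)).const_add g)).sub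
    (((((hasDerivAt_one_sub_half s).const_mul v).sub
      ((hasDerivAt_charYd P v s).div_const 2)).div (hasDerivAt_charY P v s) h0).mul
      (hasDerivAt_varT P v g s))).congr_deriv ?_
  simp only [Pi.sub_apply]
  have e := varYd_sub (g := g) h hs hs2
  have e1 := charYd_sq P v s
  have e2 := charYd_mul_varYd P v g s
  have e3 := varT_eq P v g s
  rw [jacDeriv, jac, eq_div_iff h4]
  obtain ⟨Q, hQ⟩ : ∃ Q, charYd P v s = Q * charY P v s := ⟨_, (div_mul_cancel₀ _ h0).symm⟩
  obtain ⟨a, ha⟩ : ∃ a, v = a * charY P v s := ⟨_, (div_mul_cancel₀ _ h0).symm⟩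
  simp only [Pi.div_apply, Pi.sub_apply]
  rw [hQ] at e e1 e2 ⊢
  clear hQ
  generalize charY P v s = Y at *
  generalize varY P v g s = R at *
  generalize varYd P v g s = S at *
  generalize varT P v g s = A at *
  generalize charT P v s = T at *
  subst ha
  have e2' : Q * S = (P ^ 2 + 2 * (a * Y)) * R + (P * g + (P - g) / 2 - a * Y) * Y - a * R
      - (P - g) / 2 := by
    apply mul_left_cancel₀ h0
    linear_combination e2
  have e1' : Q ^ 2 = P ^ 2 + 2 * (a * Y) - 2 * a := by
    apply mul_left_cancel₀ (pow_ne_zero 2 h0)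
    linear_combination e1
  have e4 : Q * Y / Y = Q := by field_simp
  rw [e4] at e ⊢
  have e5 : (a * Y * (1 - s / 2) - Q * Y / 2) / Y = a * (1 - s / 2) - Q / 2 := by field_simp
  have e6 : ((a * Y * -(1 / 2) - ((P ^ 2 + 2 * (a * Y)) * Y - a * Y) / 2) * Y -
      (a * Y * (1 - s / 2) - Q * Y / 2) * (Q * Y)) / Y ^ 2 =
      -(P ^ 2 + 2 * (a * Y)) / 2 - (a * (1 - s / 2) - Q / 2) * Q := by field_simp; ring
  rw [e5, e6]
  have e7 : Q * (g + (P * g + (P - g) / 2 - a * Y) * T) =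
      Q * S - Q ^ 2 * R := by linear_combination (-Q) * e
  linear_combination (1 - s / 2) * (e3 / 2 + e / 2 - (1 - s / 2) * e7 - (1 - s / 2) * e2'
    + (1 - s / 2) * R * e1')

theorem jac_zero : jac P v g 0 = 1 := by
  simp [jac, varY_zero, varT_zero]

theorem jacDeriv_zero : jacDeriv P v g 0 = g := by
  simp [jacDeriv, charT_zero, varT_zero]

theorem jacDeriv_nonpos_of_pos (h : Admissible P v) (hg : g ≤ 0) (hs : 0 ≤ s) (hs2 : s < 2)
    (hJ : ∀ r ∈ Icc 0 s, 0 < jac P v g r) : jacDeriv P v g s ≤ 0 := by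
  have key := le_of_hasDerivAt_nonneg
    (f := fun s => -(jacDeriv P v g s / (charY P v s * (1 - s / 2) ^ 2)))
    (f' := fun s => 2 * ((v * (1 - s / 2) - charYd P v s / 2) / charY P v s) * jac P v g s
      / (charY P v s * (1 - s / 2) ^ 3)) hs
    (fun r hr => ?_) fun r hr => ?_
  · have h1 := h.charY_pos hs hs2
    have h4 : 0 < 1 - s / 2 := by linarith
    simp only [jacDeriv_zero, charY_zero] at key
    norm_num at key
    have h5 := key.trans hg
    rwa [div_le_iff₀ (by positivity), zero_mul] at h5
  · have h4 : 0 < 1 - r / 2 := by linarith [hr.2]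
    have h5 := (h.charY_pos hr.1 (hr.2.trans_lt hs2)).ne'
    refine ((hasDerivAt_jacDeriv h hr.1 (hr.2.trans_lt hs2)).div
      ((hasDerivAt_charY P v r).mul ((hasDerivAt_one_sub_half r).pow 2))
      (mul_ne_zero h5 (pow_ne_zero 2 h4.ne'))).neg.congr_deriv ?_
    simp only [Pi.mul_apply, Pi.pow_apply]
    generalize 1 - r / 2 = σ at *
    field_simp
    ring
  · have h4 : 0 < 1 - r / 2 := by linarith [hr.2]
    have h5 := h.charY_pos hr.1 (hr.2.trans_lt hs2)
    have h6 := h.dev_nonneg hr.1 (hr.2.trans_lt hs2)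
    have h7 := hJ r hr
    positivity

theorem jacDeriv_add_jac_nonneg_of_pos (h : Admissible P v) (hg : -1 ≤ g) (hs : 0 ≤ s)
    (hs2 : s < 2) (hJ : ∀ r ∈ Icc 0 s, 0 < jac P v g r) :
    0 ≤ (1 - s / 2) * jacDeriv P v g s + jac P v g s := by
  have key := le_of_hasDerivAt_nonneg
    (f := fun s => ((1 - s / 2) * jacDeriv P v g s + jac P v g s) / (charY P v s * (1 - s / 2)))
    (f' := fun s => (1 / 2 - (1 - s / 2) * (charYd P v s / charY P v s)
      - 2 * ((1 - s / 2) * (v * (1 - s / 2) - charYd P v s / 2) / charY P v s)) * jac P v g s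
      / (charY P v s * (1 - s / 2) ^ 2)) hs
    (fun r hr => ?_) fun r hr => ?_
  · have h1 := h.charY_pos hs hs2
    have h4 : 0 < 1 - s / 2 := by linarith
    simp only [jacDeriv_zero, charY_zero, jac_zero] at key
    have h5 : (0 : ℝ) ≤ ((1 - 0 / 2) * g + 1) / (1 * (1 - 0 / 2)) := by norm_num; linarith
    have h6 := h5.trans key
    rwa [le_div_iff₀ (by positivity), zero_mul] at h6
  · have h4 : 0 < 1 - r / 2 := by linarith [hr.2]
    have h5 := (h.charY_pos hr.1 (hr.2.trans_lt hs2)).ne'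
    refine ((((hasDerivAt_one_sub_half r).mul (hasDerivAt_jacDeriv h hr.1
      (hr.2.trans_lt hs2))).add (hasDerivAt_jac h hr.1 (hr.2.trans_lt hs2))).div
      ((hasDerivAt_charY P v r).mul (hasDerivAt_one_sub_half r))
      (mul_ne_zero h5 h4.ne')).congr_deriv ?_
    simp only [Pi.mul_apply, Pi.add_apply]
    generalize 1 - r / 2 = σ at *
    field_simp
    ring
  · have h4 : 0 < 1 - r / 2 := by linarith [hr.2]
    have h5 := h.charY_pos hr.1 (hr.2.trans_lt hs2)
    have h6 := h.height_nonpos hr.1 (hr.2.trans_lt hs2)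
    have h7 := hJ r hr
    have h8 := h.le_slope hr.1 (hr.2.trans_lt hs2)
    have h9 := h.gt
    have : 0 ≤ 1 / 2 - (1 - r / 2) * (charYd P v r / charY P v r)
      - 2 * ((1 - r / 2) * (v * (1 - r / 2) - charYd P v r / 2) / charY P v r) := by
      have e : (1 - r / 2) * (v * (1 - r / 2) - charYd P v r / 2) / charY P v r
        = (v * (1 - r / 2) ^ 2 / charY P v r + (1 - r / 2) * (charYd P v r / charY P v r) / 2)
          - (1 - r / 2) * (charYd P v r / charY P v r) := by field_simp; ring
      rw [e]
      linarith
    positivity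

theorem sq_le_jac_of_pos (h : Admissible P v) (hg : -1 ≤ g) (hs : 0 ≤ s) (hs2 : s < 2)
    (hJ : ∀ r ∈ Icc 0 s, 0 < jac P v g r) : (1 - s / 2) ^ 2 ≤ jac P v g s := by
  have key := le_of_hasDerivAt_nonneg
    (f := fun s => jac P v g s / (1 - s / 2) ^ 2)
    (f' := fun s => ((1 - s / 2) * jacDeriv P v g s + jac P v g s) / (1 - s / 2) ^ 3) hs
    (fun r hr => ?_) fun r hr => ?_
  · have h4 : 0 < 1 - s / 2 := by linarith
    simp only [jac_zero] at key
    rw [le_div_iff₀ (by positivity)] at key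
    norm_num at key
    exact key
  · have h4 : 0 < 1 - r / 2 := by linarith [hr.2]
    refine ((hasDerivAt_jac h hr.1 (hr.2.trans_lt hs2)).div
      ((hasDerivAt_one_sub_half r).pow 2) (pow_ne_zero 2 h4.ne')).congr_deriv ?_
    simp only [Pi.pow_apply]
    generalize 1 - r / 2 = σ at *
    field_simp
    ring
  · have h4 : 0 < 1 - r / 2 := by linarith [hr.2]
    exact div_nonneg (jacDeriv_add_jac_nonneg_of_pos h hg hr.1 (hr.2.trans_lt hs2) fun q hq =>
      hJ q ⟨hq.1, hq.2.trans hr.2⟩) (by positivity)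

theorem continuous_varY (P v g : ℝ) : Continuous (varY P v g) :=
  continuous_iff_continuousAt.2 fun s => (hasDerivAt_varY P v g s).continuousAt

theorem continuous_varT (P v g : ℝ) : Continuous (varT P v g) :=
  continuous_iff_continuousAt.2 fun s => (hasDerivAt_varT P v g s).continuousAt

theorem jac_pos (h : Admissible P v) (hg : -1 ≤ g) (hs : 0 ≤ s) (hs2 : s < 2) :
    0 < jac P v g s := by
  have hσ : Continuous fun s : ℝ => 1 - s / 2 := by fun_prop
  have hcont : Continuous fun s => (1 - s / 2) * charY P v s * varY P v g s
      + (charY P v s / 2 - (1 - s / 2) * charYd P v s) * varT P v g s :=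
    ((hσ.mul (continuous_charY P v)).mul (continuous_varY P v g)).add
      ((((continuous_charY P v).div_const 2).sub (hσ.mul (continuous_charYd P v))).mul
        (continuous_varT P v g))
  have heq : ∀ r, 0 ≤ r → r < 2 → (1 - r / 2) * charY P v r * varY P v g r
      + (charY P v r / 2 - (1 - r / 2) * charYd P v r) * varT P v g r
      = charY P v r * jac P v g r := fun r hr hr2 => by
    have := (h.charY_pos hr hr2).ne'
    rw [jac]
    field_simp
  suffices key : 0 < charY P v s * jac P v g s from
    (pos_iff_pos_of_mul_pos key).1 (h.charY_pos hs hs2)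
  rw [← heq s hs hs2]
  refine pos_of_forall_Ico_pos (b := 2) hcont (fun c hc hc2 hpos => ?_) hs hs2
  rcases hc.eq_or_lt with rfl | hc0
  · rw [heq 0 le_rfl two_pos, jac_zero, charY_zero]
    norm_num
  · have hpos' : ∀ r ∈ Ico 0 c, 0 < jac P v g r := fun r hr => by
      have h1 := hpos r hr
      rw [heq r hr.1 (hr.2.trans hc2)] at h1
      exact (pos_iff_pos_of_mul_pos h1).1 (h.charY_pos hr.1 (hr.2.trans hc2))
    have h1 := nonneg_of_forall_Ico hc0
      (hcont.sub ((continuous_charY P v).mul (hσ.pow 2))) fun r hr => ?_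
    · have h2 := h.charY_pos hc hc2
      have h3 : 0 < 1 - c / 2 := by linarith
      have h4 : 0 < charY P v c * (1 - c / 2) ^ 2 := by positivity
      exact h4.trans_le (sub_nonneg.1 h1)
    · simp only [Pi.sub_apply, Pi.mul_apply, Pi.pow_apply]
      rw [heq r hr.1 (hr.2.trans hc2), ← mul_sub]
      exact mul_nonneg (h.charY_pos hr.1 (hr.2.trans hc2)).le (sub_nonneg.2
        (sq_le_jac_of_pos h hg hr.1 (hr.2.trans hc2) fun q hq => hpos' q
          ⟨hq.1, hq.2.trans_lt hr.2⟩))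

theorem jacDeriv_nonpos (h : Admissible P v) (hg : -1 ≤ g) (hg0 : g ≤ 0) (hs : 0 ≤ s)
    (hs2 : s < 2) : jacDeriv P v g s ≤ 0 :=
  jacDeriv_nonpos_of_pos h hg0 hs hs2 fun _ hr => jac_pos h hg hr.1 (hr.2.trans_lt hs2)

theorem jacDeriv_add_jac_nonneg (h : Admissible P v) (hg : -1 ≤ g) (hs : 0 ≤ s)
    (hs2 : s < 2) : 0 ≤ (1 - s / 2) * jacDeriv P v g s + jac P v g s :=
  jacDeriv_add_jac_nonneg_of_pos h hg hs hs2 fun _ hr => jac_pos h hg hr.1 (hr.2.trans_lt hs2)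

end variation

/-- Slope `p`, normalised height `v` and `g = ξ p'`, as functions of the starting point `ξ`. -/
structure CharData (m : ℝ) (p v g : ℝ → ℝ) : Prop where
  lt_half : m < 1 / 2
  hasDerivAt_slope : ∀ {ξ}, 0 < ξ → HasDerivAt p (g ξ / ξ) ξ
  hasDerivAt_height : ∀ {ξ}, 0 < ξ → HasDerivAt v (((p ξ - g ξ) / 2 - v ξ) / ξ) ξ
  continuousOn : ContinuousOn g (Ioi 0)
  admissible : ∀ {ξ}, 0 < ξ → Admissible (p ξ) (v ξ)
  neg_le_slope : ∀ {ξ}, 0 < ξ → -m ≤ p ξ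
  neg_one_le : ∀ {ξ}, 0 < ξ → -1 ≤ g ξ
  nonpos : ∀ {ξ}, 0 < ξ → g ξ ≤ 0

theorem le_of_hasDerivAt_Ioo_nonneg {f f' : ℝ → ℝ} {a b : ℝ} (hab : a ≤ b)
    (hc : ContinuousOn f (Icc a b)) (hf : ∀ s ∈ Ioo a b, HasDerivAt f (f' s) s)
    (h : ∀ s ∈ Ioo a b, 0 ≤ f' s) : f a ≤ f b := by
  refine monotoneOn_of_deriv_nonneg (convex_Icc a b) hc
    (fun s hs => ?_) (fun s hs => ?_) (left_mem_Icc.2 hab) (right_mem_Icc.2 hab) hab <;>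
  rw [interior_Icc] at hs
  · exact (hf s hs).differentiableAt.differentiableWithinAt
  · rw [(hf s hs).deriv]
    exact h s hs

section initial

variable {m : ℝ} {F₀ : ℝ → ℝ}

theorem hasDerivAt_of_contDiffOn_two (hC2 : ContDiffOn ℝ 2 F₀ (Ici 0)) {x : ℝ} (hx : 0 < x) :
    HasDerivAt F₀ (D1 F₀ x) x :=
  ((hC2.differentiableOn (by norm_num)) x hx.le).hasDerivWithinAt.hasDerivAt (Ici_mem_nhds hx)

theorem contDiffOn_D1 (hC2 : ContDiffOn ℝ 2 F₀ (Ici 0)) : ContDiffOn ℝ 1 (D1 F₀) (Ici 0) :=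
  hC2.derivWithin (uniqueDiffOn_Ici 0) (by norm_num)

theorem hasDerivAt_D1 (hC2 : ContDiffOn ℝ 2 F₀ (Ici 0)) {x : ℝ} (hx : 0 < x) :
    HasDerivAt (D1 F₀) (D2 F₀ x) x :=
  (((contDiffOn_D1 hC2).differentiableOn (by norm_num)) x hx.le).hasDerivWithinAt.hasDerivAt
    (Ici_mem_nhds hx)

theorem charData_of_initial (hm₀ : 0 < m) (hm₁ : m < 1 / 2)
    (hC2 : ContDiffOn ℝ 2 F₀ (Ici 0))
    (hBd : ∀ x : ℝ, 0 ≤ x → 0 ≤ F₀ x ∧ F₀ x ≤ m * x)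
    (hA1 : ∀ x : ℝ, 0 ≤ x → 0 ≤ D1 F₀ x ∧ D1 F₀ x ≤ m)
    (hA3 : ∀ x : ℝ, 0 < x → -(m / Real.exp 1) ≤ x * D2 F₀ x ∧ x * D2 F₀ x ≤ 0) :
    CharData m (fun ξ => D1 F₀ ξ - m) (fun ξ => F₀ ξ / ξ - m - (D1 F₀ ξ - m) / 2)
      (fun ξ => ξ * D2 F₀ ξ) := by
  have hF0 : F₀ 0 = 0 := by
    have := hBd 0 le_rfl
    linarith
  have he : m / Real.exp 1 ≤ 1 / 4 := by
    have := Real.add_one_le_exp 1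
    rw [div_le_iff₀ (Real.exp_pos 1)]
    linarith
  have hc0 : ContinuousOn F₀ (Ici 0) := hC2.continuousOn
  have hc1 : ContinuousOn (D1 F₀) (Ici 0) := (contDiffOn_D1 hC2).continuousOn
  refine ⟨hm₁, fun {ξ} hξ => ?_, fun {ξ} hξ => ?_, ?_, fun {ξ} hξ => ⟨?_, ?_, ?_, ?_⟩,
    fun {ξ} hξ => ?_, fun {ξ} hξ => ?_, fun {ξ} hξ => (hA3 ξ hξ).2⟩
  · exact ((hasDerivAt_D1 hC2 hξ).sub_const m).congr_deriv (by field_simp)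
  · refine ((((hasDerivAt_of_contDiffOn_two hC2 hξ).div (hasDerivAt_id ξ) hξ.ne').sub_const m).sub
      (((hasDerivAt_D1 hC2 hξ).sub_const m).div_const 2)).congr_deriv ?_
    simp only [id]
    field_simp
    ring
  · have : ContinuousOn (D2 F₀) (Ici 0) :=
      (contDiffOn_D1 hC2).continuousOn_derivWithin (uniqueDiffOn_Ici 0) le_rfl
    exact continuousOn_id.mul (this.mono Ioi_subset_Ici_self)
  · linarith [(hA1 ξ hξ.le).1]
  · linarith [(hA1 ξ hξ.le).2]
  · have key := le_of_hasDerivAt_Ioo_nonneg (f := fun x => F₀ x - x * D1 F₀ x)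
      (f' := fun x => -(x * D2 F₀ x)) hξ.le
      ((hc0.sub (continuousOn_id.mul hc1)).mono Icc_subset_Ici_self)
      (fun s hs => ((hasDerivAt_of_contDiffOn_two hC2 hs.1).sub
        ((hasDerivAt_id s).mul (hasDerivAt_D1 hC2 hs.1))).congr_deriv (by simp))
      fun s hs => neg_nonneg.2 (hA3 s hs.1).2
    simp only [hF0, zero_mul, sub_zero] at key
    have : D1 F₀ ξ ≤ F₀ ξ / ξ := by rw [le_div_iff₀ hξ]; linarith
    linarith
  · have key := le_of_hasDerivAt_Ioo_nonneg
      (f := fun x => -(F₀ x - m * x + x * (D1 F₀ x - m) ^ 2 / 2))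
      (f' := fun x => (m - D1 F₀ x) * (1 + (D1 F₀ x - m) / 2 + x * D2 F₀ x)) hξ.le
      (((hc0.sub (continuousOn_const.mul continuousOn_id)).add
        ((continuousOn_id.mul ((hc1.sub continuousOn_const).pow 2)).div_const 2)).neg.mono
        Icc_subset_Ici_self)
      (fun s hs => ((((hasDerivAt_of_contDiffOn_two hC2 hs.1).sub
        ((hasDerivAt_id s).const_mul m)).add (((hasDerivAt_id s).mul
        (((hasDerivAt_D1 hC2 hs.1).sub_const m).pow 2)).div_const 2)).neg).congr_deriv (by
          simp
          ring))
      fun s hs => mul_nonneg (sub_nonneg.2 (hA1 s hs.1.le).2)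
        (by linarith [(hA1 s hs.1.le).1, (hA3 s hs.1).1])
    simp only [hF0, zero_mul, mul_zero, sub_zero, zero_div, add_zero, neg_zero] at key
    have : F₀ ξ / ξ - m + (D1 F₀ ξ - m) ^ 2 / 2 ≤ 0 := by
      have e : F₀ ξ / ξ - m + (D1 F₀ ξ - m) ^ 2 / 2
        = (F₀ ξ - m * ξ + ξ * (D1 F₀ ξ - m) ^ 2 / 2) / ξ := by field_simp
      rw [e]
      exact div_nonpos_of_nonpos_of_nonneg (by linarith) hξ.le
    linarith
  · linarith [(hA1 ξ hξ.le).1]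
  · linarith [(hA3 ξ hξ).1]

end initial

/-- A `C¹` function of two variables has the strict derivative given by its partial derivatives. -/
theorem ContDiffAt.hasStrictFDerivAt_of_partial {f : ℝ × ℝ → ℝ} {a b fa fb : ℝ}
    (hf : ContDiffAt ℝ 1 f (a, b)) (ha : HasDerivAt (fun x => f (x, b)) fa a)
    (hb : HasDerivAt (fun y => f (a, y)) fb b) :
    HasStrictFDerivAt f
      (fa • ContinuousLinearMap.fst ℝ ℝ ℝ + fb • ContinuousLinearMap.snd ℝ ℝ ℝ) (a, b) := by
  have h := hf.hasStrictFDerivAt (by norm_num)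
  have h1 := h.hasFDerivAt.comp_hasDerivAt a
    ((hasDerivAt_id a).prodMk (hasDerivAt_const a b))
  have h2 := h.hasFDerivAt.comp_hasDerivAt b
    ((hasDerivAt_const b a).prodMk (hasDerivAt_id b))
  have e1 := h1.unique ha
  have e2 := h2.unique hb
  refine h.congr_fderiv ?_
  ext
  · simpa using e1
  · simpa using e2

/-- The linear automorphism of the plane with a given invertible matrix. -/
noncomputable def planeEquiv (a b c d : ℝ) (h : a * d - b * c ≠ 0) : (ℝ × ℝ) ≃L[ℝ] (ℝ × ℝ) :=
  ContinuousLinearEquiv.equivOfInverse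
    ((a • ContinuousLinearMap.fst ℝ ℝ ℝ + b • ContinuousLinearMap.snd ℝ ℝ ℝ).prod
      (c • ContinuousLinearMap.fst ℝ ℝ ℝ + d • ContinuousLinearMap.snd ℝ ℝ ℝ))
    (((d / (a * d - b * c)) • ContinuousLinearMap.fst ℝ ℝ ℝ
        + (-b / (a * d - b * c)) • ContinuousLinearMap.snd ℝ ℝ ℝ).prod
      ((-c / (a * d - b * c)) • ContinuousLinearMap.fst ℝ ℝ ℝ
        + (a / (a * d - b * c)) • ContinuousLinearMap.snd ℝ ℝ ℝ))
    (fun p => by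
      obtain ⟨D, hD⟩ : ∃ D, D = a * d - b * c := ⟨_, rfl⟩
      rw [← hD] at h ⊢
      ext <;> simp <;> field_simp <;> rw [hD] <;> ring)
    (fun p => by
      obtain ⟨D, hD⟩ : ∃ D, D = a * d - b * c := ⟨_, rfl⟩
      rw [← hD] at h ⊢
      ext <;> simp <;> field_simp <;> rw [hD] <;> ring)

theorem planeEquiv_symm_apply (a b c d : ℝ) (h : a * d - b * c ≠ 0) (z : ℝ × ℝ) :
    (planeEquiv a b c d h).symm z = (d / (a * d - b * c) * z.1 + -b / (a * d - b * c) * z.2,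
      -c / (a * d - b * c) * z.1 + a / (a * d - b * c) * z.2) :=
  rfl

/-- The characteristic flow `(ξ, s) ↦ (x, t)`. -/
noncomputable def flow (p v : ℝ → ℝ) (q : ℝ × ℝ) : ℝ × ℝ :=
  (q.1 * charY (p q.1) (v q.1) q.2 * (1 - q.2 / 2), q.1 * charT (p q.1) (v q.1) q.2)

/-- The value transported by the characteristic flow. -/
noncomputable def flowValue (m : ℝ) (p v : ℝ → ℝ) (q : ℝ × ℝ) : ℝ :=
  m * (q.1 * charY (p q.1) (v q.1) q.2 * (1 - q.2 / 2))
    + (v q.1 * q.1 * (1 - q.2 / 2) ^ 3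
      + (1 - q.2 / 2) ^ 2 * (q.1 * charYd (p q.1) (v q.1) q.2) / 2)

namespace CharData

variable {m : ℝ} {p v g : ℝ → ℝ} (h : CharData m p v g) {ξ s : ℝ}

include h

theorem contDiffAt_slope (hξ : 0 < ξ) : ContDiffAt ℝ 1 p ξ := by
  have : ContDiffOn ℝ (0 + 1) p (Ioi 0) := by
    rw [contDiffOn_succ_iff_deriv_of_isOpen isOpen_Ioi]
    refine ⟨fun x hx => (h.hasDerivAt_slope hx).differentiableAt.differentiableWithinAt, by simp,
      contDiffOn_zero.2 ?_⟩
    exact (h.continuousOn.div continuousOn_id fun x hx => ne_of_gt hx).congr fun x hx =>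
      (h.hasDerivAt_slope hx).deriv
  rw [zero_add] at this
  exact this.contDiffAt (Ioi_mem_nhds hξ)

theorem contDiffAt_height (hξ : 0 < ξ) : ContDiffAt ℝ 1 v ξ := by
  have : ContDiffOn ℝ (0 + 1) v (Ioi 0) := by
    rw [contDiffOn_succ_iff_deriv_of_isOpen isOpen_Ioi]
    refine ⟨fun x hx => (h.hasDerivAt_height hx).differentiableAt.differentiableWithinAt, by simp,
      contDiffOn_zero.2 ?_⟩
    have hp : ContinuousOn p (Ioi 0) := fun x hx =>
      (h.hasDerivAt_slope hx).continuousAt.continuousWithinAt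
    have hv : ContinuousOn v (Ioi 0) := fun x hx =>
      (h.hasDerivAt_height hx).continuousAt.continuousWithinAt
    exact ((((hp.sub h.continuousOn).div_const 2).sub hv).div continuousOn_id fun x hx =>
      ne_of_gt hx).congr fun x hx => (h.hasDerivAt_height hx).deriv
  rw [zero_add] at this
  exact this.contDiffAt (Ioi_mem_nhds hξ)

theorem contDiffAt_slope_fst (hξ : 0 < ξ) : ContDiffAt ℝ 1 (fun q : ℝ × ℝ => p q.1) (ξ, s) :=
  (h.contDiffAt_slope hξ).comp (ξ, s) contDiffAt_fst

theorem contDiffAt_height_fst (hξ : 0 < ξ) : ContDiffAt ℝ 1 (fun q : ℝ × ℝ => v q.1) (ξ, s) :=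
  (h.contDiffAt_height hξ).comp (ξ, s) contDiffAt_fst

theorem contDiffAt_coshPrim_comp (j : ℕ) (hξ : 0 < ξ) :
    ContDiffAt ℝ 1 (fun q : ℝ × ℝ => coshPrim j (p q.1 ^ 2 + 2 * v q.1) q.2) (ξ, s) :=
  (contDiff_coshPrim j).contDiffAt.comp (ξ, s)
    ((((h.contDiffAt_slope_fst hξ).pow 2).add
      (contDiffAt_const.mul (h.contDiffAt_height_fst hξ))).prodMk contDiffAt_snd)

theorem contDiffAt_charY (hξ : 0 < ξ) :
    ContDiffAt ℝ 1 (fun q : ℝ × ℝ => charY (p q.1) (v q.1) q.2) (ξ, s) := by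
  have hp := h.contDiffAt_slope_fst (s := s) hξ
  have hv := h.contDiffAt_height_fst (s := s) hξ
  exact (contDiffAt_const.add (hp.mul (h.contDiffAt_coshPrim_comp 1 hξ))).add
    (((hp.pow 2).add hv).mul (h.contDiffAt_coshPrim_comp 2 hξ))

theorem contDiffAt_charYd (hξ : 0 < ξ) :
    ContDiffAt ℝ 1 (fun q : ℝ × ℝ => charYd (p q.1) (v q.1) q.2) (ξ, s) := by
  have hp := h.contDiffAt_slope_fst (s := s) hξ
  have hv := h.contDiffAt_height_fst (s := s) hξ
  exact (hp.mul (h.contDiffAt_coshPrim_comp 0 hξ)).add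
    (((hp.pow 2).add hv).mul (h.contDiffAt_coshPrim_comp 1 hξ))

theorem contDiffAt_charT (hξ : 0 < ξ) :
    ContDiffAt ℝ 1 (fun q : ℝ × ℝ => charT (p q.1) (v q.1) q.2) (ξ, s) := by
  have hp := h.contDiffAt_slope_fst (s := s) hξ
  have hv := h.contDiffAt_height_fst (s := s) hξ
  exact (contDiffAt_snd.add (hp.mul (h.contDiffAt_coshPrim_comp 2 hξ))).add
    (((hp.pow 2).add hv).mul (h.contDiffAt_coshPrim_comp 3 hξ))

theorem hasDerivAt_energy (hξ : 0 < ξ) :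
    HasDerivAt (fun ξ => p ξ ^ 2 + 2 * v ξ)
      (2 * (p ξ * g ξ + (p ξ - g ξ) / 2 - v ξ) / ξ) ξ := by
  refine (((h.hasDerivAt_slope hξ).pow 2).add
    ((h.hasDerivAt_height hξ).const_mul 2)).congr_deriv ?_
  push_cast
  field_simp
  ring

theorem hasDerivAt_coshPrim_energy (j : ℕ) (s : ℝ) (hξ : 0 < ξ) :
    HasDerivAt (fun ξ => coshPrim j (p ξ ^ 2 + 2 * v ξ) s)
      ((s * coshPrim (j + 1) (p ξ ^ 2 + 2 * v ξ) s - j * coshPrim (j + 2) (p ξ ^ 2 + 2 * v ξ) s) / 2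
        * (2 * (p ξ * g ξ + (p ξ - g ξ) / 2 - v ξ) / ξ)) ξ :=
  HasDerivAt.comp (h₂ := fun l => coshPrim j l s) ξ
    (hasDerivAt_coshPrim_left j (p ξ ^ 2 + 2 * v ξ) s) (h.hasDerivAt_energy hξ)

theorem hasDerivAt_mul_charY (s : ℝ) (hξ : 0 < ξ) :
    HasDerivAt (fun ξ => ξ * charY (p ξ) (v ξ) s) (varY (p ξ) (v ξ) (g ξ) s) ξ := by
  have hp := h.hasDerivAt_slope hξ
  have hv := h.hasDerivAt_height hξ
  refine ((hasDerivAt_id ξ).mul (((hp.mul (h.hasDerivAt_coshPrim_energy 1 s hξ)).const_add 1).add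
    (((hp.pow 2).add hv).mul (h.hasDerivAt_coshPrim_energy 2 s hξ)))).congr_deriv ?_
  simp only [varY, charY, id, Nat.reduceAdd, Pi.add_apply, Pi.mul_apply, Pi.pow_apply]
  push_cast
  field_simp
  ring

theorem hasDerivAt_mul_charYd (s : ℝ) (hξ : 0 < ξ) :
    HasDerivAt (fun ξ => ξ * charYd (p ξ) (v ξ) s) (varYd (p ξ) (v ξ) (g ξ) s) ξ := by
  have hp := h.hasDerivAt_slope hξ
  have hv := h.hasDerivAt_height hξ
  refine ((hasDerivAt_id ξ).mul ((hp.mul (h.hasDerivAt_coshPrim_energy 0 s hξ)).add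
    (((hp.pow 2).add hv).mul (h.hasDerivAt_coshPrim_energy 1 s hξ)))).congr_deriv ?_
  simp only [varYd, charYd, id, Nat.reduceAdd, Pi.add_apply, Pi.mul_apply, Pi.pow_apply]
  push_cast
  field_simp
  ring

theorem hasDerivAt_mul_charT (s : ℝ) (hξ : 0 < ξ) :
    HasDerivAt (fun ξ => ξ * charT (p ξ) (v ξ) s) (varT (p ξ) (v ξ) (g ξ) s) ξ := by
  have hp := h.hasDerivAt_slope hξ
  have hv := h.hasDerivAt_height hξ
  refine ((hasDerivAt_id ξ).mul (((hp.mul (h.hasDerivAt_coshPrim_energy 2 s hξ)).const_add s).add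
    (((hp.pow 2).add hv).mul (h.hasDerivAt_coshPrim_energy 3 s hξ)))).congr_deriv ?_
  simp only [varT, charT, id, Nat.reduceAdd, Pi.add_apply, Pi.mul_apply, Pi.pow_apply]
  push_cast
  field_simp
  ring

theorem contDiffAt_flow_fst (hξ : 0 < ξ) :
    ContDiffAt ℝ 1 (fun q => (flow p v q).1) (ξ, s) :=
  (contDiffAt_fst.mul (h.contDiffAt_charY hξ)).mul
    (contDiffAt_const.sub (contDiffAt_snd.div_const 2))

theorem contDiffAt_flow_snd (hξ : 0 < ξ) :
    ContDiffAt ℝ 1 (fun q => (flow p v q).2) (ξ, s) :=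
  contDiffAt_fst.mul (h.contDiffAt_charT hξ)

theorem contDiffAt_flow (hξ : 0 < ξ) : ContDiffAt ℝ 1 (flow p v) (ξ, s) :=
  (h.contDiffAt_flow_fst hξ).prodMk (h.contDiffAt_flow_snd hξ)

theorem contDiffAt_flowValue (hξ : 0 < ξ) : ContDiffAt ℝ 1 (flowValue m p v) (ξ, s) := by
  have hσ : ContDiffAt ℝ 1 (fun q : ℝ × ℝ => 1 - q.2 / 2) (ξ, s) :=
    contDiffAt_const.sub (contDiffAt_snd.div_const 2)
  exact (contDiffAt_const.mul (h.contDiffAt_flow_fst hξ)).add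
    ((((h.contDiffAt_height_fst hξ).mul contDiffAt_fst).mul (hσ.pow 3)).add
      (((hσ.pow 2).mul (contDiffAt_fst.mul (h.contDiffAt_charYd hξ))).div_const 2))

theorem hasStrictFDerivAt_flow_fst (hξ : 0 < ξ) :
    HasStrictFDerivAt (fun q => (flow p v q).1)
      (((1 - s / 2) * varY (p ξ) (v ξ) (g ξ) s) • ContinuousLinearMap.fst ℝ ℝ ℝ
        + (ξ * ((1 - s / 2) * charYd (p ξ) (v ξ) s - charY (p ξ) (v ξ) s / 2)) •
          ContinuousLinearMap.snd ℝ ℝ ℝ) (ξ, s) := by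
  refine (h.contDiffAt_flow_fst hξ).hasStrictFDerivAt_of_partial ?_ ?_
  · exact ((h.hasDerivAt_mul_charY s hξ).mul_const (1 - s / 2)).congr_deriv (by ring)
  · exact (((hasDerivAt_charY (p ξ) (v ξ) s).const_mul ξ).mul
      (hasDerivAt_one_sub_half s)).congr_deriv (by ring)

theorem hasStrictFDerivAt_flow_snd (hξ : 0 < ξ) :
    HasStrictFDerivAt (fun q => (flow p v q).2)
      (varT (p ξ) (v ξ) (g ξ) s • ContinuousLinearMap.fst ℝ ℝ ℝ
        + (ξ * charY (p ξ) (v ξ) s) • ContinuousLinearMap.snd ℝ ℝ ℝ) (ξ, s) :=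
  (h.contDiffAt_flow_snd hξ).hasStrictFDerivAt_of_partial (h.hasDerivAt_mul_charT s hξ)
    ((hasDerivAt_charT (p ξ) (v ξ) s).const_mul ξ)

theorem det_eq (hξ : 0 < ξ) (hs : 0 ≤ s) (hs2 : s < 2) :
    (1 - s / 2) * varY (p ξ) (v ξ) (g ξ) s * (ξ * charY (p ξ) (v ξ) s)
      - ξ * ((1 - s / 2) * charYd (p ξ) (v ξ) s - charY (p ξ) (v ξ) s / 2)
        * varT (p ξ) (v ξ) (g ξ) s
      = ξ * charY (p ξ) (v ξ) s * jac (p ξ) (v ξ) (g ξ) s := by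
  have := ((h.admissible hξ).charY_pos hs hs2).ne'
  rw [jac]
  field_simp
  ring

theorem jac_pos (hξ : 0 < ξ) (hs : 0 ≤ s) (hs2 : s < 2) : 0 < jac (p ξ) (v ξ) (g ξ) s :=
  _root_.jac_pos (h.admissible hξ) (h.neg_one_le hξ) hs hs2

theorem det_ne_zero (hξ : 0 < ξ) (hs : 0 ≤ s) (hs2 : s < 2) :
    (1 - s / 2) * varY (p ξ) (v ξ) (g ξ) s * (ξ * charY (p ξ) (v ξ) s)
      - ξ * ((1 - s / 2) * charYd (p ξ) (v ξ) s - charY (p ξ) (v ξ) s / 2)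
        * varT (p ξ) (v ξ) (g ξ) s ≠ 0 := by
  rw [h.det_eq hξ hs hs2]
  exact (mul_pos (mul_pos hξ ((h.admissible hξ).charY_pos hs hs2)) (h.jac_pos hξ hs hs2)).ne'

theorem hasStrictFDerivAt_flow (hξ : 0 < ξ) (hs : 0 ≤ s) (hs2 : s < 2) :
    HasStrictFDerivAt (flow p v)
      (planeEquiv _ _ _ _ (h.det_ne_zero hξ hs hs2) : ℝ × ℝ →L[ℝ] ℝ × ℝ) (ξ, s) :=
  (h.hasStrictFDerivAt_flow_fst hξ).prodMk (h.hasStrictFDerivAt_flow_snd hξ)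

theorem hasStrictFDerivAt_flowValue (hξ : 0 < ξ) (hs : 0 ≤ s) (hs2 : s < 2) :
    HasStrictFDerivAt (flowValue m p v)
      ((((1 - s / 2) * (charYd (p ξ) (v ξ) s / charY (p ξ) (v ξ) s) + m) •
          ContinuousLinearMap.fst ℝ ℝ ℝ
        + (-((1 - s / 2) ^ 2 * (p ξ ^ 2 + 2 * v ξ) / 2)) • ContinuousLinearMap.snd ℝ ℝ ℝ).comp
        (planeEquiv _ _ _ _ (h.det_ne_zero hξ hs hs2) : ℝ × ℝ →L[ℝ] ℝ × ℝ)) (ξ, s) := by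
  have h0 := ((h.admissible hξ).charY_pos hs hs2).ne'
  have key := (h.contDiffAt_flowValue (s := s) hξ).hasStrictFDerivAt_of_partial
    (((h.hasDerivAt_mul_charY s hξ).mul_const (1 - s / 2)).const_mul m |>.add
      ((((h.hasDerivAt_height hξ).mul (hasDerivAt_id ξ)).mul_const ((1 - s / 2) ^ 3)).add
        (((h.hasDerivAt_mul_charYd s hξ).const_mul ((1 - s / 2) ^ 2)).div_const 2)))
    (((((hasDerivAt_charY (p ξ) (v ξ) s).const_mul ξ).mul
      (hasDerivAt_one_sub_half s)).const_mul m).add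
      ((((hasDerivAt_one_sub_half s).pow 3).const_mul (v ξ * ξ)).add
        ((((hasDerivAt_one_sub_half s).pow 2).mul
          ((hasDerivAt_charYd (p ξ) (v ξ) s).const_mul ξ)).div_const 2)))
  refine key.congr_fderiv ?_
  have e := varYd_sub (g := g ξ) (h.admissible hξ) hs hs2
  have e1 := charYd_sq (p ξ) (v ξ) s
  have e3 := varT_eq (p ξ) (v ξ) (g ξ) s
  ext
  · simp [planeEquiv]
    rw [div_mul_cancel₀ _ hξ.ne']
    linear_combination (1 - s / 2) ^ 2 * (e + e3 / 2)
  · simp [planeEquiv]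
    field_simp
    linear_combination (-8 * (1 - s / 2) ^ 2) * e1

end CharData

theorem HasDerivAt.eventually_lt_of_pos {f : ℝ → ℝ} {f' x : ℝ} (hf : HasDerivAt f f' x)
    (hf' : 0 < f') : ∀ᶠ y in nhdsWithin x (Ioi x), f x < f y := by
  have h := (hasDerivAt_iff_tendsto_slope.1 hf).eventually (lt_mem_nhds hf')
  have h1 : ∀ᶠ y in nhdsWithin x (Ioi x), 0 < slope f x y :=
    h.filter_mono (nhdsWithin_mono _ fun y hy => ne_of_gt hy)
  filter_upwards [h1, self_mem_nhdsWithin] with y hy hxy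
  rw [slope_def_field] at hy
  have := (div_pos_iff_of_pos_right (sub_pos.2 hxy)).1 hy
  linarith

namespace Admissible

variable {P v s : ℝ} (h : Admissible P v)

include h

theorem charT_le (hs : 0 ≤ s) (hs2 : s ≤ 2) : charT P v s ≤ s := by
  have key := le_of_hasDerivAt_Ioo_nonneg (f := fun s => s - charT P v s)
    (f' := fun s => 1 - charY P v s) hs
    (by
      have : Continuous (charT P v) :=
        continuous_iff_continuousAt.2 fun r => (hasDerivAt_charT P v r).continuousAt
      fun_prop)
    (fun r _ => (hasDerivAt_id r).sub (hasDerivAt_charT P v r))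
    fun r hr => sub_nonneg.2 (h.charY_le_one hr.1.le (hr.2.trans_le hs2))
  simp only [charT_zero] at key
  linarith

theorem one_le_charY_mul_add_charT (hs : 0 ≤ s) (hs2 : s ≤ 2) :
    1 ≤ charY P v s * (1 - s / 2) + charT P v s := by
  have key := le_of_hasDerivAt_Ioo_nonneg
    (f := fun s => charY P v s * (1 - s / 2) + charT P v s)
    (f' := fun s => charYd P v s * (1 - s / 2) + charY P v s * (-(1 / 2)) + charY P v s) hs
    (by
      have : Continuous (charT P v) :=
        continuous_iff_continuousAt.2 fun r => (hasDerivAt_charT P v r).continuousAt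
      have := continuous_charY P v
      fun_prop)
    (fun r _ => ((hasDerivAt_charY P v r).mul (hasDerivAt_one_sub_half r)).add
      (hasDerivAt_charT P v r))
    fun r hr => by
      have hr2 := hr.2.trans_le hs2
      have hY := h.charY_pos hr.1.le hr2
      have h1 := mul_le_mul_of_nonneg_right (h.le_slope hr.1.le hr2) hY.le
      rw [mul_assoc, div_mul_cancel₀ _ hY.ne'] at h1
      nlinarith [h.gt]
  simpa [charY_zero, charT_zero] using key

end Admissible

namespace CharData

variable {m : ℝ} {p v g : ℝ → ℝ} (h : CharData m p v g) {ξ s : ℝ}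

theorem pos_of_flow_snd_pos (hs : 0 ≤ s) (ht : 0 < (flow p v (ξ, s)).2) : 0 < s := by
  refine hs.lt_of_ne fun h0 => ?_
  subst h0
  simp [flow, charT_zero] at ht

theorem lt_two_of_flow_fst_pos (hs : s ≤ 2) (hx : 0 < (flow p v (ξ, s)).1) : s < 2 := by
  refine hs.lt_of_ne fun h0 => ?_
  subst h0
  simp [flow] at hx

include h

theorem flow_fst_pos (hξ : 0 < ξ) (hs : 0 ≤ s) (hs2 : s < 2) : 0 < (flow p v (ξ, s)).1 :=
  mul_pos (mul_pos hξ ((h.admissible hξ).charY_pos hs hs2)) (by linarith)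

theorem flow_fst_le (hξ : 0 < ξ) (hs : 0 ≤ s) (hs2 : s ≤ 2) : (flow p v (ξ, s)).1 ≤ ξ := by
  rcases hs2.eq_or_lt with rfl | hs2
  · simp [flow, hξ.le]
  · have h1 := (h.admissible hξ).charY_le_one hs hs2
    have h0 := (h.admissible hξ).charY_pos hs hs2
    have : charY (p ξ) (v ξ) s * (1 - s / 2) ≤ 1 := mul_le_one₀ h1 (by linarith) (by linarith)
    simp only [flow]
    rw [mul_assoc]
    exact mul_le_of_le_one_right hξ.le this

theorem le_flow_fst (hξ : 0 < ξ) (hs : 0 ≤ s) (hs2 : s < 2) :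
    ξ * (1 - s / 2) ^ 2 ≤ (flow p v (ξ, s)).1 := by
  have h1 := (h.admissible hξ).sub_le_charY hs hs2
  simp only [flow]
  rw [mul_assoc, pow_two]
  gcongr
  linarith

theorem flow_snd_le (hξ : 0 < ξ) (hs : 0 ≤ s) (hs2 : s ≤ 2) :
    (flow p v (ξ, s)).2 ≤ ξ * s := by
  have := (h.admissible hξ).charT_le hs hs2
  simp only [flow]
  gcongr

theorem le_flow_add (hξ : 0 < ξ) (hs : 0 ≤ s) (hs2 : s ≤ 2) :
    ξ ≤ (flow p v (ξ, s)).1 + (flow p v (ξ, s)).2 := by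
  have := mul_le_mul_of_nonneg_left
    ((h.admissible hξ).one_le_charY_mul_add_charT hs hs2) hξ.le
  simp only [flow]
  linarith

theorem strictMonoOn_flow_snd (hξ : 0 < ξ) :
    StrictMonoOn (fun s => (flow p v (ξ, s)).2) (Icc 0 2) := by
  have hd : ∀ s, HasDerivAt (fun s => (flow p v (ξ, s)).2) (ξ * charY (p ξ) (v ξ) s) s :=
    fun s => (hasDerivAt_charT (p ξ) (v ξ) s).const_mul ξ
  refine strictMonoOn_of_deriv_pos (convex_Icc 0 2)
    (fun s _ => (hd s).continuousAt.continuousWithinAt) fun s hs => ?_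
  rw [interior_Icc] at hs
  rw [(hd s).deriv]
  exact mul_pos hξ ((h.admissible hξ).charY_pos hs.1.le hs.2)

theorem continuousOn_flow : ContinuousOn (flow p v) (Ioi 0 ×ˢ univ) :=
  fun q hq => (h.contDiffAt_flow (ξ := q.1) (s := q.2) hq.1).continuousAt.continuousWithinAt

theorem flow_mem (hξ : 0 < ξ) (hs : s ∈ Ioo (0 : ℝ) 2) :
    flow p v (ξ, s) ∈ Ioi (0 : ℝ) ×ˢ Ioi (0 : ℝ) := by
  refine ⟨h.flow_fst_pos hξ hs.1.le hs.2, ?_⟩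
  have := h.strictMonoOn_flow_snd hξ ⟨le_rfl, by norm_num⟩ ⟨hs.1.le, hs.2.le⟩ hs.1
  simpa [flow, charT_zero] using this

theorem isOpen_image_flow : IsOpen (flow p v '' (Ioi 0 ×ˢ Ioo 0 2)) := by
  rw [isOpen_iff_mem_nhds]
  rintro _ ⟨⟨ξ, s⟩, ⟨hξ, hs⟩, rfl⟩
  rw [← (h.hasStrictFDerivAt_flow hξ hs.1.le hs.2).map_nhds_eq_of_equiv]
  exact image_mem_map ((isOpen_Ioi.prod isOpen_Ioo).mem_nhds ⟨hξ, hs⟩)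

theorem surjOn_flow : SurjOn (flow p v) (Ioi 0 ×ˢ Ioo 0 2) (Ioi 0 ×ˢ Ioi 0) := by
  refine IsPreconnected.subset_of_closure_inter_subset (isPreconnected_Ioi.prod isPreconnected_Ioi)
    h.isOpen_image_flow ⟨flow p v (1, 1), h.flow_mem one_pos (by norm_num),
      mem_image_of_mem _ (by norm_num)⟩ ?_
  rintro ⟨x, t⟩ ⟨hz, hx, ht⟩
  simp only [mem_Ioi] at hx ht
  have hK : IsCompact (Icc (x / 2) (x + t + 2) ×ˢ Icc (0 : ℝ) 2) := isCompact_Icc.prod isCompact_Icc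
  have hU : Ioo (x / 2) (x + 1) ×ˢ Iio (t + 1) ∈ nhds (x, t) :=
    (isOpen_Ioo.prod isOpen_Iio).mem_nhds ⟨⟨by linarith, by linarith⟩, by simp⟩
  have hcl : IsClosed (flow p v '' (Icc (x / 2) (x + t + 2) ×ˢ Icc (0 : ℝ) 2)) :=
    (hK.image_of_continuousOn (h.continuousOn_flow.mono fun q hq =>
      ⟨(half_pos hx).trans_le hq.1.1, trivial⟩)).isClosed
  have hmem : (x, t) ∈ flow p v '' (Icc (x / 2) (x + t + 2) ×ˢ Icc (0 : ℝ) 2) := by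
    rw [← hcl.closure_eq]
    refine closure_mono ?_ (mem_closure_iff_nhds.2 fun V hV => ?_ :
      (x, t) ∈ closure (flow p v '' (Ioi 0 ×ˢ Ioo 0 2) ∩ Ioo (x / 2) (x + 1) ×ˢ Iio (t + 1)))
    · rintro _ ⟨⟨⟨ξ, s⟩, ⟨hξ, hs⟩, rfl⟩, h1, h2⟩
      simp only [mem_Ioi] at hξ
      refine mem_image_of_mem _ ⟨⟨h1.1.le.trans (h.flow_fst_le hξ hs.1.le hs.2.le), ?_⟩,
        hs.1.le, hs.2.le⟩
      have := h.le_flow_add hξ hs.1.le hs.2.le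
      have := h1.2
      simp only [mem_Iio] at h2
      simp only
      linarith
    · obtain ⟨w, hw, hw'⟩ := mem_closure_iff_nhds.1 hz _ (inter_mem hV hU)
      exact ⟨w, hw.1, hw', hw.2⟩
  obtain ⟨⟨ξ, s⟩, ⟨hξ, hs⟩, he⟩ := hmem
  refine ⟨(ξ, s), ⟨(half_pos hx).trans_le hξ.1,
    pos_of_flow_snd_pos (p := p) (v := v) (ξ := ξ) hs.1 ?_,
    lt_two_of_flow_fst_pos (p := p) (v := v) (ξ := ξ) hs.2 ?_⟩, he⟩ <;> simpa [he]

/-- Following a level line of time, the position increases with the label. -/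
theorem exists_right (hξ : 0 < ξ) (hs : s ∈ Ioo (0 : ℝ) 2) {y : ℝ} (hy : ξ < y) :
    ∃ ξ' ∈ Ioo ξ y, ∃ s' ∈ Ioo (0 : ℝ) 2, (flow p v (ξ', s')).2 = (flow p v (ξ, s)).2 ∧
      (flow p v (ξ, s)).1 < (flow p v (ξ', s')).1 := by
  have hΦ := h.hasStrictFDerivAt_flow hξ hs.1.le hs.2
  have hinv := hΦ.to_localInverse.hasFDerivAt
  have hcurve : HasDerivAt (fun ε : ℝ => ((flow p v (ξ, s)).1 + ε, (flow p v (ξ, s)).2))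
      (1, 0) 0 := ((hasDerivAt_id (0 : ℝ)).const_add _).prodMk (hasDerivAt_const _ _)
  have hc0 : ((flow p v (ξ, s)).1 + 0, (flow p v (ξ, s)).2) = flow p v (ξ, s) := by simp
  have hloc : hΦ.localInverse (flow p v) _ (ξ, s) (flow p v (ξ, s)) = (ξ, s) :=
    hΦ.localInverse_apply_image
  have hk := hasFDerivAt_fst.comp_hasDerivAt (0 : ℝ)
    (HasFDerivAt.comp_hasDerivAt_of_eq (0 : ℝ) hinv hcurve hc0.symm)
  have hpos : 0 < (ContinuousLinearMap.fst ℝ ℝ ℝ)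
      (((planeEquiv _ _ _ _ (h.det_ne_zero hξ hs.1.le hs.2)).symm : ℝ × ℝ →L[ℝ] ℝ × ℝ) (1, 0)) := by
    have hY := (h.admissible hξ).charY_pos hs.1.le hs.2
    rw [ContinuousLinearEquiv.coe_coe, planeEquiv_symm_apply, ContinuousLinearMap.coe_fst',
      h.det_eq hξ hs.1.le hs.2, mul_one, mul_zero, add_zero]
    have := h.jac_pos hξ hs.1.le hs.2
    positivity
  have hev1 := hk.eventually_lt_of_pos hpos
  simp only [Function.comp_def, add_zero] at hev1
  have htend : Tendsto (fun ε : ℝ => ((flow p v (ξ, s)).1 + ε, (flow p v (ξ, s)).2))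
      (nhdsWithin 0 (Ioi 0)) (nhds (flow p v (ξ, s))) := by
    have := hcurve.continuousAt.tendsto
    rw [hc0] at this
    exact this.mono_left nhdsWithin_le_nhds
  have hev2 := htend.eventually hΦ.eventually_right_inverse
  have hev3 := htend.eventually (hΦ.localInverse_tendsto.eventually
    ((isOpen_Iio.prod isOpen_Ioo).mem_nhds (⟨hy, hs⟩ : (ξ, s) ∈ Iio y ×ˢ Ioo (0 : ℝ) 2)))
  obtain ⟨ε, ⟨⟨h1, h2⟩, h3⟩, h4⟩ :=
    (((hev1.and hev2).and hev3).and self_mem_nhdsWithin).exists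
  refine ⟨_, ⟨?_, h3.1⟩, _, h3.2, ?_, ?_⟩
  · simpa [hloc] using h1
  · rw [Prod.mk.eta, h2]
  · rw [Prod.mk.eta, h2]
    simpa using h4

theorem not_lt_of_flow_eq {ξ₁ s₁ ξ₂ s₂ : ℝ} (hξ₁ : 0 < ξ₁) (hs₁ : s₁ ∈ Ioo (0 : ℝ) 2)
    (hs₂ : s₂ ∈ Ioo (0 : ℝ) 2) (he : flow p v (ξ₁, s₁) = flow p v (ξ₂, s₂)) : ¬ ξ₁ < ξ₂ := by
  intro hlt
  obtain ⟨a, ha, r, hr, hT, hX⟩ := h.exists_right hξ₁ hs₁ hlt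
  have ha0 : 0 < a := hξ₁.trans ha.1
  have hX0 := h.flow_fst_pos ha0 hr.1.le hr.2
  have hT0 := (h.flow_mem ha0 hr).2
  simp only [mem_Ioi] at hT0
  let S : Set ℝ := {ξ | ∃ s ∈ Icc (0 : ℝ) 2, (flow p v (ξ, s)).2 = (flow p v (a, r)).2 ∧
    (flow p v (a, r)).1 ≤ (flow p v (ξ, s)).1}
  have hclosed : IsClosed (S ∩ Icc a ξ₂) := by
    have hK : IsCompact (Icc a ξ₂ ×ˢ Icc (0 : ℝ) 2) := isCompact_Icc.prod isCompact_Icc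
    have hcont : ContinuousOn (flow p v) (Icc a ξ₂ ×ˢ Icc (0 : ℝ) 2) :=
      h.continuousOn_flow.mono fun q hq => ⟨ha0.trans_le hq.1.1, trivial⟩
    have hcl : IsClosed {z : ℝ × ℝ | z.2 = (flow p v (a, r)).2 ∧ (flow p v (a, r)).1 ≤ z.1} :=
      (isClosed_eq continuous_snd continuous_const).inter
        (isClosed_le continuous_const continuous_fst)
    have hcpt := hK.of_isClosed_subset (hcont.preimage_isClosed_of_isClosed hK.isClosed hcl)
      inter_subset_left
    convert (hcpt.image continuous_fst).isClosed using 1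
    ext ξ
    constructor
    · rintro ⟨⟨s, hs, h1⟩, h2⟩
      exact ⟨(ξ, s), ⟨⟨h2, hs⟩, h1⟩, rfl⟩
    · rintro ⟨⟨ξ, s⟩, ⟨⟨h2, hs⟩, h1⟩, rfl⟩
      exact ⟨⟨s, hs, h1⟩, h2⟩
  have hsub := hclosed.Icc_subset_of_forall_exists_gt
    (⟨r, ⟨hr.1.le, hr.2.le⟩, rfl, le_rfl⟩ : a ∈ S) fun ξ hξ y hy => by
      obtain ⟨⟨s, hs, hT, hX⟩, hξa, -⟩ := hξ
      have hs' : s ∈ Ioo (0 : ℝ) 2 := ⟨pos_of_flow_snd_pos hs.1 (hT ▸ hT0),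
        lt_two_of_flow_fst_pos hs.2 (hX0.trans_le hX)⟩
      obtain ⟨ξ', hξ', s', hs', hT', hX'⟩ := h.exists_right (ha0.trans_le hξa) hs' hy
      exact ⟨ξ', ⟨s', ⟨hs'.1.le, hs'.2.le⟩, hT'.trans hT, hX.trans hX'.le⟩, hξ'.1, hξ'.2.le⟩
  obtain ⟨s, hs, hT', hX'⟩ := hsub ⟨ha.2.le, le_rfl⟩
  have : s = s₂ := (h.strictMonoOn_flow_snd (hξ₁.trans hlt)).injOn hs ⟨hs₂.1.le, hs₂.2.le⟩
    (by rw [hT', hT, he])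
  subst this
  rw [he] at hX
  linarith

theorem injOn_flow : InjOn (flow p v) (Ioi 0 ×ˢ Ioo 0 2) := by
  rintro ⟨ξ₁, s₁⟩ ⟨hξ₁, hs₁⟩ ⟨ξ₂, s₂⟩ ⟨hξ₂, hs₂⟩ he
  have : ξ₁ = ξ₂ := le_antisymm (not_lt.1 (h.not_lt_of_flow_eq hξ₂ hs₂ hs₁ he.symm))
    (not_lt.1 (h.not_lt_of_flow_eq hξ₁ hs₁ hs₂ he))
  subst this
  exact congrArg (Prod.mk ξ₁) ((h.strictMonoOn_flow_snd hξ₁).injOn ⟨hs₁.1.le, hs₁.2.le⟩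
    ⟨hs₂.1.le, hs₂.2.le⟩ (congrArg Prod.snd he))

end CharData

/-- The space derivative, minus `m`, transported by the characteristic flow. -/
noncomputable def slopeAt (p v : ℝ → ℝ) (q : ℝ × ℝ) : ℝ :=
  (1 - q.2 / 2) * (charYd (p q.1) (v q.1) q.2 / charY (p q.1) (v q.1) q.2)

/-- The time derivative, with the opposite sign, transported by the characteristic flow. -/
noncomputable def energyAt (p v : ℝ → ℝ) (q : ℝ × ℝ) : ℝ :=
  (1 - q.2 / 2) ^ 2 * (p q.1 ^ 2 + 2 * v q.1) / 2

/-- The inverse of the characteristic flow on the open quadrant. -/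
noncomputable def label (p v : ℝ → ℝ) : ℝ × ℝ → ℝ × ℝ :=
  Function.invFunOn (flow p v) (Ioi 0 ×ˢ Ioo 0 2)

/-- The solution of the Hamilton–Jacobi equation given by the method of characteristics. -/
noncomputable def charSol (m : ℝ) (p v : ℝ → ℝ) (z : ℝ × ℝ) : ℝ :=
  flowValue m p v (label p v z)

theorem hasDerivAt_flow_fst (p v : ℝ → ℝ) (ξ s : ℝ) :
    HasDerivAt (fun s => (flow p v (ξ, s)).1)
      (ξ * ((1 - s / 2) * charYd (p ξ) (v ξ) s - charY (p ξ) (v ξ) s / 2)) s :=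
  (((hasDerivAt_charY (p ξ) (v ξ) s).const_mul ξ).mul
    (hasDerivAt_one_sub_half s)).congr_deriv (by ring)

namespace CharData

variable {m : ℝ} {p v g : ℝ → ℝ} (h : CharData m p v g)

include h

theorem label_flow {q : ℝ × ℝ} (hq : q ∈ Ioi (0 : ℝ) ×ˢ Ioo (0 : ℝ) 2) :
    label p v (flow p v q) = q :=
  h.injOn_flow.leftInvOn_invFunOn hq

section point

variable {ξ s : ℝ}

theorem label_eventuallyEq (hξ : 0 < ξ) (hs : s ∈ Ioo (0 : ℝ) 2) :
    label p v =ᶠ[nhds (flow p v (ξ, s))]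
      (h.hasStrictFDerivAt_flow hξ hs.1.le hs.2).localInverse (flow p v) _ (ξ, s) := by
  have hΦ := h.hasStrictFDerivAt_flow hξ hs.1.le hs.2
  filter_upwards [hΦ.eventually_right_inverse, hΦ.localInverse_tendsto.eventually
    ((isOpen_Ioi.prod isOpen_Ioo).mem_nhds (⟨hξ, hs⟩ : (ξ, s) ∈ Ioi (0 : ℝ) ×ˢ Ioo (0 : ℝ) 2))]
    with z h1 h2
  rw [← h.label_flow h2, h1]

theorem hasStrictFDerivAt_label (hξ : 0 < ξ) (hs : s ∈ Ioo (0 : ℝ) 2) :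
    HasStrictFDerivAt (label p v)
      ((planeEquiv _ _ _ _ (h.det_ne_zero hξ hs.1.le hs.2)).symm : ℝ × ℝ →L[ℝ] ℝ × ℝ)
      (flow p v (ξ, s)) :=
  (h.hasStrictFDerivAt_flow hξ hs.1.le hs.2).to_localInverse.congr_of_eventuallyEq
    (h.label_eventuallyEq hξ hs).symm

theorem contDiffAt_label_flow (hξ : 0 < ξ) (hs : s ∈ Ioo (0 : ℝ) 2) :
    ContDiffAt ℝ 1 (label p v) (flow p v (ξ, s)) :=
  ((h.contDiffAt_flow hξ).to_localInverse
    (h.hasStrictFDerivAt_flow hξ hs.1.le hs.2).hasFDerivAt one_ne_zero).congr_of_eventuallyEq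
    (h.label_eventuallyEq hξ hs)

theorem hasFDerivAt_charSol_flow (hξ : 0 < ξ) (hs : s ∈ Ioo (0 : ℝ) 2) :
    HasFDerivAt (charSol m p v) ((slopeAt p v (ξ, s) + m) • ContinuousLinearMap.fst ℝ ℝ ℝ
      + (-energyAt p v (ξ, s)) • ContinuousLinearMap.snd ℝ ℝ ℝ) (flow p v (ξ, s)) := by
  have h1 := (h.hasStrictFDerivAt_label hξ hs).hasFDerivAt
  have h2 := (h.hasStrictFDerivAt_flowValue hξ hs.1.le hs.2).hasFDerivAt
  rw [← h.label_flow (⟨hξ, hs⟩ : (ξ, s) ∈ Ioi (0 : ℝ) ×ˢ Ioo (0 : ℝ) 2)] at h2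
  refine (h2.comp _ h1).congr_fderiv ?_
  rw [ContinuousLinearMap.comp_assoc, ContinuousLinearEquiv.coe_comp_coe_symm,
    ContinuousLinearMap.comp_id]
  rfl

theorem contDiffAt_slopeAt (hξ : 0 < ξ) (hs : 0 ≤ s) (hs2 : s < 2) :
    ContDiffAt ℝ 1 (slopeAt p v) (ξ, s) :=
  (contDiffAt_const.sub (contDiffAt_snd.div_const 2)).mul
    ((h.contDiffAt_charYd hξ).div (h.contDiffAt_charY hξ)
      ((h.admissible hξ).charY_pos hs hs2).ne')

theorem contDiffAt_energyAt (hξ : 0 < ξ) : ContDiffAt ℝ 1 (energyAt p v) (ξ, s) :=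
  (((contDiffAt_const.sub (contDiffAt_snd.div_const 2)).pow 2).mul
    (((h.contDiffAt_slope_fst hξ).pow 2).add
      (contDiffAt_const.mul (h.contDiffAt_height_fst hξ)))).div_const 2

theorem slopeAt_nonpos (hξ : 0 < ξ) (hs : 0 ≤ s) (hs2 : s < 2) : slopeAt p v (ξ, s) ≤ 0 :=
  (h.admissible hξ).slope_nonpos hs hs2

theorem neg_le_slopeAt (hξ : 0 < ξ) (hs : 0 ≤ s) (hs2 : s < 2) : -m ≤ slopeAt p v (ξ, s) :=
  (h.neg_le_slope hξ).trans ((h.admissible hξ).le_slope hs hs2)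

theorem abs_energyAt_le (hξ : 0 < ξ) :
    |energyAt p v (ξ, s)| ≤ (1 - s / 2) ^ 2 / 4 := by
  have := (h.admissible hξ).abs_energy_le
  have h4 := sq_nonneg (1 - s / 2)
  rw [energyAt, abs_div, abs_mul, abs_of_nonneg h4, abs_two]
  simp only
  nlinarith

theorem flowValue_div (hξ : 0 < ξ) (hs : 0 ≤ s) (hs2 : s < 2) :
    flowValue m p v (ξ, s) / (flow p v (ξ, s)).1 = m
      + (v ξ * (1 - s / 2) ^ 2 / charY (p ξ) (v ξ) s
        + (1 - s / 2) * (charYd (p ξ) (v ξ) s / charY (p ξ) (v ξ) s) / 2) := by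
  have h1 := ((h.admissible hξ).charY_pos hs hs2).ne'
  have h2 : 1 - s / 2 ≠ 0 := by intro h; linarith
  simp only [flowValue, flow]
  generalize 1 - s / 2 = σ at *
  field_simp

theorem flowValue_equation (hξ : 0 < ξ) (hs : 0 ≤ s) (hs2 : s < 2) :
    -energyAt p v (ξ, s) + 1 / 2 * slopeAt p v (ξ, s) * (slopeAt p v (ξ, s) - 1)
      + flowValue m p v (ξ, s) / (flow p v (ξ, s)).1 - m = 0 := by
  rw [h.flowValue_div hξ hs hs2]
  have := (h.admissible hξ).slope_sq hs hs2
  simp only [energyAt, slopeAt]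
  linear_combination (1 - s / 2) ^ 2 / 2 * this

theorem flowValue_bounds (hξ : 0 < ξ) (hs : 0 ≤ s) (hs2 : s < 2) :
    (m + slopeAt p v (ξ, s)) * (flow p v (ξ, s)).1 ≤ flowValue m p v (ξ, s)
      ∧ flowValue m p v (ξ, s) ≤ m * (flow p v (ξ, s)).1 := by
  have hX := h.flow_fst_pos hξ hs hs2
  have h1 := (h.admissible hξ).height_nonpos hs hs2
  have h2 := (h.admissible hξ).slope_le_height hs hs2
  rw [← le_div_iff₀ hX, ← div_le_iff₀ hX, h.flowValue_div hξ hs hs2]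
  simp only [slopeAt]
  constructor <;> linarith

theorem hasDerivAt_flowValue (hξ : 0 < ξ) (hs : 0 ≤ s) (hs2 : s < 2) :
    HasDerivAt (fun s => flowValue m p v (ξ, s))
      (ξ * charY (p ξ) (v ξ) s *
        ((slopeAt p v (ξ, s) + m) * (slopeAt p v (ξ, s) - 1 / 2) - energyAt p v (ξ, s))) s := by
  have := (h.hasStrictFDerivAt_flowValue hξ hs hs2).hasFDerivAt.comp_hasDerivAt s
    ((hasDerivAt_const s ξ).prodMk (hasDerivAt_id s))
  refine this.congr_deriv ?_
  have h1 := ((h.admissible hξ).charY_pos hs hs2).ne'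
  simp [planeEquiv, slopeAt, energyAt]
  field_simp
  ring

end point

theorem abs_flowValue_sub_le {F₀ : ℝ → ℝ} (hF₀ : ∀ x, 0 < x → HasDerivAt F₀ (p x + m) x)
    (hv : ∀ x, 0 < x → F₀ x = m * x + (v x + p x / 2) * x) {ξ s : ℝ} (hξ : 0 < ξ) (hs : 0 ≤ s)
    (hs2 : s < 2) :
    |flowValue m p v (ξ, s) - F₀ (flow p v (ξ, s)).1| ≤ (flow p v (ξ, s)).2 := by
  have h0 : flowValue m p v (ξ, 0) - F₀ (flow p v (ξ, 0)).1 = 0 := by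
    simp [flowValue, flow, charY_zero, charYd_zero, hv ξ hξ]
    ring
  have hT0 : (flow p v (ξ, 0)).2 = 0 := by simp [flow, charT_zero]
  have hd : ∀ r ∈ Icc 0 s, HasDerivAt
      (fun r => flowValue m p v (ξ, r) - F₀ (flow p v (ξ, r)).1)
      (ξ * charY (p ξ) (v ξ) r * ((slopeAt p v (ξ, r) - p (flow p v (ξ, r)).1) *
        (slopeAt p v (ξ, r) - 1 / 2) - energyAt p v (ξ, r))) r := by
    intro r hr
    have hr2 := hr.2.trans_lt hs2
    have hX := h.flow_fst_pos hξ hr.1 hr2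
    refine ((h.hasDerivAt_flowValue hξ hr.1 hr2).sub
      (HasDerivAt.comp (h₂ := F₀) r (hF₀ _ hX) (hasDerivAt_flow_fst p v ξ r))).congr_deriv ?_
    have h1 := ((h.admissible hξ).charY_pos hr.1 hr2).ne'
    simp only [slopeAt]
    generalize p (flow p v (ξ, r)).1 = a
    field_simp
    ring
  have hT : ∀ r, HasDerivAt (fun r => (flow p v (ξ, r)).2) (ξ * charY (p ξ) (v ξ) r) r :=
    fun r => (hasDerivAt_charT (p ξ) (v ξ) r).const_mul ξ
  have hb : ∀ r ∈ Icc 0 s, |(slopeAt p v (ξ, r) - p (flow p v (ξ, r)).1) *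
        (slopeAt p v (ξ, r) - 1 / 2) - energyAt p v (ξ, r)| ≤ 1 := by
    intro r hr
    have hr2 := hr.2.trans_lt hs2
    have hX := h.flow_fst_pos hξ hr.1 hr2
    have e1 := h.slopeAt_nonpos hξ hr.1 hr2
    have e2 := h.neg_le_slopeAt hξ hr.1 hr2
    have e3 := h.neg_le_slope hX
    have e4 := (h.admissible hX).le
    have e5 := h.lt_half
    have e6 := h.abs_energyAt_le (s := r) hξ
    have e7 : (1 - r / 2) ^ 2 ≤ 1 := by nlinarith [hr.1]
    have e8 : |slopeAt p v (ξ, r) - p (flow p v (ξ, r)).1| ≤ 1 / 2 := by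
      rw [abs_le]; constructor <;> linarith
    have e9 : |slopeAt p v (ξ, r) - 1 / 2| ≤ 1 := by
      rw [abs_le]; constructor <;> linarith
    calc _ ≤ |(slopeAt p v (ξ, r) - p (flow p v (ξ, r)).1) * (slopeAt p v (ξ, r) - 1 / 2)|
          + |energyAt p v (ξ, r)| := abs_sub _ _
      _ ≤ 1 / 2 * 1 + 1 / 4 := by
        rw [abs_mul]
        gcongr
        linarith
      _ ≤ 1 := by norm_num
  have hY : ∀ r ∈ Icc 0 s, 0 ≤ ξ * charY (p ξ) (v ξ) r := fun r hr =>
    mul_nonneg hξ.le ((h.admissible hξ).charY_pos hr.1 (hr.2.trans_lt hs2)).le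
  have k1 := le_of_hasDerivAt_nonneg hs (fun r hr => (hT r).sub (hd r hr)) fun r hr => by
    have := mul_le_mul_of_nonneg_left (abs_le.1 (hb r hr)).2 (hY r hr)
    linarith
  have k2 := le_of_hasDerivAt_nonneg hs (fun r hr => (hT r).add (hd r hr)) fun r hr => by
    have := mul_le_mul_of_nonneg_left (abs_le.1 (hb r hr)).1 (hY r hr)
    linarith
  simp only [Pi.sub_apply, Pi.add_apply, h0, hT0] at k1 k2
  rw [abs_le]
  constructor <;> linarith

end CharData

/-- A germ of `C¹` function extends to a global `C¹` function. -/
theorem ContDiffAt.exists_contDiff_eventuallyEq {φ : ℝ × ℝ → ℝ} {z : ℝ × ℝ}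
    (hφ : ContDiffAt ℝ 1 φ z) : ∃ ψ : ℝ × ℝ → ℝ, ContDiff ℝ 1 ψ ∧ ψ =ᶠ[nhds z] φ := by
  obtain ⟨r, hr, hball⟩ := Metric.eventually_nhds_iff_ball.1 (hφ.eventually (by simp))
  let f : ContDiffBump z := ⟨r / 3, r / 2, by positivity, by linarith⟩
  refine ⟨fun y => f y * φ y, contDiff_iff_contDiffAt.2 fun y => ?_, ?_⟩
  · by_cases hy : y ∈ tsupport f
    · rw [f.tsupport_eq] at hy
      exact f.contDiffAt.mul (hball y (Metric.closedBall_subset_ball (half_lt_self hr) hy))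
    · exact (contDiffAt_const (c := (0 : ℝ))).congr_of_eventuallyEq
        ((notMem_tsupport_iff_eventuallyEq.1 hy).mono fun w hw => by simp [hw])
  · filter_upwards [f.eventuallyEq_one] with y hy
    simp [hy]

theorem HasFDerivAt.hasDerivAt_fst {f : ℝ × ℝ → ℝ} {a b x t : ℝ}
    (hf : HasFDerivAt f (a • ContinuousLinearMap.fst ℝ ℝ ℝ + b • ContinuousLinearMap.snd ℝ ℝ ℝ)
      (x, t)) : HasDerivAt (fun y => f (y, t)) a x :=
  (hf.comp_hasDerivAt x ((hasDerivAt_id x).prodMk (hasDerivAt_const x t))).congr_deriv (by simp)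

theorem HasFDerivAt.hasDerivAt_snd {f : ℝ × ℝ → ℝ} {a b x t : ℝ}
    (hf : HasFDerivAt f (a • ContinuousLinearMap.fst ℝ ℝ ℝ + b • ContinuousLinearMap.snd ℝ ℝ ℝ)
      (x, t)) : HasDerivAt (fun s => f (x, s)) b t :=
  (hf.comp_hasDerivAt t ((hasDerivAt_const t x).prodMk (hasDerivAt_id t))).congr_deriv (by simp)

section viscosity

variable {m : ℝ} {F : ℝ → ℝ → ℝ} {φ : ℝ × ℝ → ℝ} {a b x t : ℝ}

theorem IsSubsolutionHJ.le_zero (hF : IsSubsolutionHJ m F) (hx : 0 < x) (ht : 0 < t)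
    (hφ : ContDiffAt ℝ 1 φ (x, t))
    (hd : HasFDerivAt φ (a • ContinuousLinearMap.fst ℝ ℝ ℝ + b • ContinuousLinearMap.snd ℝ ℝ ℝ)
      (x, t))
    (hmax : IsLocalMax (fun z : ℝ × ℝ => F z.1 z.2 - φ z) (x, t)) :
    b + 1 / 2 * (a - m) * (a - m - 1) + F x t / x - m ≤ 0 := by
  obtain ⟨ψ, hψ, he⟩ := hφ.exists_contDiff_eventuallyEq
  have hd' := hd.congr_of_eventuallyEq he
  have := hF ψ hψ x t hx ht ((hmax.congr (he.mono fun y hy => by simp only [hy])).on _)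
  rwa [hd'.hasDerivAt_fst.deriv, hd'.hasDerivAt_snd.deriv] at this

theorem IsSupersolutionHJ.ge_zero (hF : IsSupersolutionHJ m F) (hx : 0 < x) (ht : 0 < t)
    (hφ : ContDiffAt ℝ 1 φ (x, t))
    (hd : HasFDerivAt φ (a • ContinuousLinearMap.fst ℝ ℝ ℝ + b • ContinuousLinearMap.snd ℝ ℝ ℝ)
      (x, t))
    (hmin : IsLocalMin (fun z : ℝ × ℝ => F z.1 z.2 - φ z) (x, t)) :
    0 ≤ b + 1 / 2 * (a - m) * (a - m - 1) + F x t / x - m := by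
  obtain ⟨ψ, hψ, he⟩ := hφ.exists_contDiff_eventuallyEq
  have hd' := hd.congr_of_eventuallyEq he
  have := hF ψ hψ x t hx ht ((hmin.congr (he.mono fun y hy => by simp only [hy])).on _)
  rwa [hd'.hasDerivAt_fst.deriv, hd'.hasDerivAt_snd.deriv] at this

end viscosity

/-- The penalisation `x + 2t + 1/(T-t)`. -/
noncomputable def penalty (T : ℝ) (z : ℝ × ℝ) : ℝ := z.1 + 2 * z.2 + 1 / (T - z.2)

theorem contDiffAt_penalty {T : ℝ} {z : ℝ × ℝ} (hz : z.2 < T) : ContDiffAt ℝ 1 (penalty T) z :=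
  (contDiffAt_fst.add (contDiffAt_const.mul contDiffAt_snd)).add
    (contDiffAt_const.div (contDiffAt_const.sub contDiffAt_snd) (sub_pos.2 hz).ne')

theorem hasFDerivAt_penalty {T x t : ℝ} (ht : t < T) :
    HasFDerivAt (penalty T) ((1 : ℝ) • ContinuousLinearMap.fst ℝ ℝ ℝ
      + (2 + 1 / (T - t) ^ 2) • ContinuousLinearMap.snd ℝ ℝ ℝ) (x, t) := by
  refine ((contDiffAt_penalty (z := (x, t)) ht).hasStrictFDerivAt_of_partial ?_ ?_).hasFDerivAt
  · exact ((hasDerivAt_id x).add_const (2 * t)).add_const (1 / (T - t))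
  · have h0 : T - t ≠ 0 := (sub_pos.2 ht).ne'
    exact ((((hasDerivAt_id t).const_mul 2).const_add x).add
      ((hasDerivAt_const t 1).div ((hasDerivAt_id t).const_sub T) h0)).congr_deriv (by simp)

/-- A function which is somewhere positive, and controlled at the boundary of the quadrant and
at infinity, has a positive penalised maximum. -/
theorem exists_isLocalMax_sub_penalty {D : ℝ × ℝ → ℝ} {L M : ℝ} (hL : 0 ≤ L)
    (hcont : ContinuousOn D (Ioi 0 ×ˢ Ioi 0))
    (hDx : ∀ z ∈ Ioi (0 : ℝ) ×ˢ Ioi (0 : ℝ), D z ≤ z.1)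
    (hDt : ∀ z ∈ Ioi (0 : ℝ) ×ˢ Ioi (0 : ℝ), D z ≤ L * z.2)
    (hDM : ∀ z ∈ Ioi (0 : ℝ) ×ˢ Ioi (0 : ℝ), D z ≤ M + L * z.2)
    {z₁ : ℝ × ℝ} (hz₁ : z₁ ∈ Ioi (0 : ℝ) ×ˢ Ioi (0 : ℝ)) (hpos : 0 < D z₁) :
    ∃ ε ∈ Ioc (0 : ℝ) 1, ∃ T, ∃ z ∈ Ioi (0 : ℝ) ×ˢ Ioi (0 : ℝ), z.2 < T ∧
      0 < D z ∧ IsLocalMax (fun y => D y - ε * penalty T y) z := by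
  obtain ⟨T, hT⟩ : ∃ T, T = z₁.2 + 1 := ⟨_, rfl⟩
  have hx₁ : 0 < z₁.1 := hz₁.1
  have ht₁ : 0 < z₁.2 := hz₁.2
  have hT0 : 0 < T := by linarith
  have hp1 : 0 < penalty T z₁ := by
    have : T - z₁.2 = 1 := by linarith
    rw [penalty, this]
    positivity
  obtain ⟨ε, hε, hε1, hεp⟩ : ∃ ε, 0 < ε ∧ ε ≤ 1 ∧ ε * penalty T z₁ < D z₁ := by
    refine ⟨min 1 (D z₁ / 2 / penalty T z₁), by positivity, min_le_left _ _, ?_⟩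
    calc _ ≤ D z₁ / 2 / penalty T z₁ * penalty T z₁ := by
          gcongr
          exact min_le_right _ _
      _ < D z₁ := by
          rw [div_mul_cancel₀ _ hp1.ne']
          linarith
  obtain ⟨R, hR⟩ : ∃ R, R = (M + L * T) / ε := ⟨_, rfl⟩
  have hbound : ∀ z ∈ Ioi (0 : ℝ) ×ˢ Ioi (0 : ℝ), z.2 < T → ε * penalty T z < D z → z.1 < R := by
    intro z hz hzT hw
    have hx : 0 < z.1 := hz.1
    have ht : 0 < z.2 := hz.2
    have h1 : 0 < 1 / (T - z.2) := one_div_pos.2 (sub_pos.2 hzT)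
    rw [hR, lt_div_iff₀ hε]
    have h2 := hDM z hz
    have h3 : L * z.2 ≤ L * T := by gcongr
    rw [penalty] at hw
    nlinarith [mul_pos hε ht, mul_pos hε h1]
  have hR0 : 0 < R := hx₁.trans (hbound z₁ hz₁ (by linarith) hεp)
  obtain ⟨ρ, hρ, hρT, hρL, hρR⟩ : ∃ ρ, 0 < ρ ∧ T * ρ ≤ ε ∧ L * T * ρ ≤ ε ∧ R * ρ ≤ ε := by
    have hN : 0 < T + L * T + R := by positivity
    have hLT : 0 ≤ L * T := by positivity
    refine ⟨ε / (T + L * T + R), by positivity, ?_, ?_, ?_⟩ <;>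
    · rw [← mul_div_assoc, div_le_iff₀ hN]
      nlinarith [mul_pos hε hT0, mul_nonneg hε.le hLT, mul_pos hε hR0]
  have hin : ∀ z ∈ Ioi (0 : ℝ) ×ˢ Ioi (0 : ℝ), z.2 < T → ε * penalty T z < D z →
      z ∈ Ioo ρ R ×ˢ Ioo ρ (T - ρ) := by
    intro z hz hzT hw
    have hx : 0 < z.1 := hz.1
    have ht : 0 < z.2 := hz.2
    have hxR := hbound z hz hzT hw
    have hTz := sub_pos.2 hzT
    have h1 : ε * (1 / (T - z.2)) < D z := by
      rw [penalty] at hw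
      nlinarith [mul_pos hε ht, mul_pos hε hx]
    rw [mul_one_div, div_lt_iff₀ hTz] at h1
    have h2 : ε < D z * T := by
      have : 0 < D z := by
        by_contra! hneg
        nlinarith
      nlinarith
    refine ⟨⟨?_, hxR⟩, ?_, ?_⟩ <;> by_contra! hle
    · nlinarith [hDx z hz]
    · have := hDt z hz
      have : L * z.2 ≤ L * ρ := by gcongr
      nlinarith
    · have h4 := hDx z hz
      have : D z * (T - z.2) ≤ R * ρ := by
        have h5 : D z ≤ R := by linarith
        have h6 : T - z.2 ≤ ρ := by linarith
        gcongr
      linarith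
  have hCQ : Icc ρ R ×ˢ Icc ρ (T - ρ) ⊆ Ioi (0 : ℝ) ×ˢ Ioi (0 : ℝ) :=
    prod_mono (fun x hx => hρ.trans_le hx.1) fun x hx => hρ.trans_le hx.1
  have hC : IsCompact (Icc ρ R ×ˢ Icc ρ (T - ρ)) := isCompact_Icc.prod isCompact_Icc
  have hz₁C := hin z₁ hz₁ (by linarith) hεp
  obtain ⟨z, hz, hmax⟩ := hC.exists_isMaxOn
    ⟨z₁, Ioo_subset_Icc_self hz₁C.1, Ioo_subset_Icc_self hz₁C.2⟩
    ((hcont.mono hCQ).sub (continuousOn_const.mul fun y hy =>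
      (contDiffAt_penalty (T := T) (z := y)
        (by linarith [hy.2.2])).continuousAt.continuousWithinAt))
  have hzT : z.2 < T := by linarith [hz.2.2]
  have hzpos : ε * penalty T z < D z := by
    have : D z₁ - ε * penalty T z₁ ≤ D z - ε * penalty T z :=
      hmax ⟨Ioo_subset_Icc_self hz₁C.1, Ioo_subset_Icc_self hz₁C.2⟩
    linarith
  have hzin := hin z (hCQ hz) hzT hzpos
  refine ⟨ε, ⟨hε, hε1⟩, T, z, hCQ hz, hzT, ?_, hmax.isLocalMax
    (mem_of_superset ((isOpen_Ioo.prod isOpen_Ioo).mem_nhds hzin)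
      (prod_mono Ioo_subset_Icc_self Ioo_subset_Icc_self))⟩
  have h1 : 0 < 1 / (T - z.2) := one_div_pos.2 (sub_pos.2 hzT)
  have hx : 0 < z.1 := (hCQ hz).1
  have ht : 0 < z.2 := (hCQ hz).2
  have : 0 < penalty T z := by rw [penalty]; positivity
  exact (mul_pos hε this).trans hzpos

/-- A `C¹` solution of (HJ) on the open quadrant, with space derivative `a + m` and time
derivative `b`, attaining the initial value `F₀`. -/
structure IsClassicalSolution (m : ℝ) (F₀ : ℝ → ℝ) (G a b : ℝ × ℝ → ℝ) : Prop where
  contDiffAt : ∀ {z : ℝ × ℝ}, z ∈ Ioi (0 : ℝ) ×ˢ Ioi (0 : ℝ) → ContDiffAt ℝ 1 G z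
  hasFDerivAt : ∀ {z : ℝ × ℝ}, z ∈ Ioi (0 : ℝ) ×ˢ Ioi (0 : ℝ) →
    HasFDerivAt G ((a z + m) • ContinuousLinearMap.fst ℝ ℝ ℝ
      + b z • ContinuousLinearMap.snd ℝ ℝ ℝ) z
  equation : ∀ {z : ℝ × ℝ}, z ∈ Ioi (0 : ℝ) ×ˢ Ioi (0 : ℝ) →
    b z + 1 / 2 * a z * (a z - 1) + G z / z.1 - m = 0
  neg_le_slope : ∀ {z : ℝ × ℝ}, z ∈ Ioi (0 : ℝ) ×ˢ Ioi (0 : ℝ) → -m ≤ a z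
  slope_nonpos : ∀ {z : ℝ × ℝ}, z ∈ Ioi (0 : ℝ) ×ˢ Ioi (0 : ℝ) → a z ≤ 0
  nonneg : ∀ {z : ℝ × ℝ}, z ∈ Ioi (0 : ℝ) ×ˢ Ioi (0 : ℝ) → 0 ≤ G z
  le_mul : ∀ {z : ℝ × ℝ}, z ∈ Ioi (0 : ℝ) ×ˢ Ioi (0 : ℝ) → G z ≤ m * z.1
  abs_sub_le : ∀ {z : ℝ × ℝ}, z ∈ Ioi (0 : ℝ) ×ˢ Ioi (0 : ℝ) → |G z - F₀ z.1| ≤ z.2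

namespace IsClassicalSolution

variable {m : ℝ} {F₀ : ℝ → ℝ} {G a b : ℝ × ℝ → ℝ} (hG : IsClassicalSolution m F₀ G a b)
  {F : ℝ → ℝ → ℝ} {z : ℝ × ℝ}

include hG

theorem le_of_isSubsolution (hm : m ≤ 1 / 2) (hF : IsSubsolutionHJ m F) {ε T : ℝ} (hε : 0 < ε)
    (hz : z ∈ Ioi (0 : ℝ) ×ˢ Ioi (0 : ℝ)) (hzT : z.2 < T)
    (hmax : IsLocalMax (fun y => F y.1 y.2 - G y - ε * penalty T y) z) :
    F z.1 z.2 ≤ G z := by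
  obtain ⟨x, t⟩ := z
  have hx : 0 < x := hz.1
  have hTt : 0 < T - t := sub_pos.2 hzT
  have hd := (hG.hasFDerivAt hz).add ((hasFDerivAt_penalty (x := x) hzT).const_mul ε)
  have key := hF.le_zero (φ := fun y => G y + ε * penalty T y) (a := a (x, t) + m + ε)
    (b := b (x, t) + ε * (2 + 1 / (T - t) ^ 2)) hx hz.2
    ((hG.contDiffAt hz).add (contDiffAt_const.mul (contDiffAt_penalty hzT)))
    (hd.congr_fderiv (by ext <;> simp)) (by simpa only [sub_sub] using hmax)
  have e := hG.equation hz
  have e1 := hG.neg_le_slope hz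
  simp only at e ⊢
  by_contra! hlt
  have h1 : G (x, t) / x < F x t / x := by gcongr
  have h2 : 0 < 1 / (T - t) ^ 2 := by positivity
  nlinarith [mul_pos hε h2, mul_pos hε hε]

theorem le_of_isSupersolution (hm : m ≤ 1 / 2) (hF : IsSupersolutionHJ m F) {ε T : ℝ}
    (hε : 0 < ε) (hε1 : ε ≤ 1)
    (hz : z ∈ Ioi (0 : ℝ) ×ˢ Ioi (0 : ℝ)) (hzT : z.2 < T)
    (hmax : IsLocalMax (fun y => G y - F y.1 y.2 - ε * penalty T y) z) :
    G z ≤ F z.1 z.2 := by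
  obtain ⟨x, t⟩ := z
  have hx : 0 < x := hz.1
  have hTt : 0 < T - t := sub_pos.2 hzT
  have hd := (hG.hasFDerivAt hz).sub ((hasFDerivAt_penalty (x := x) hzT).const_mul ε)
  have key := hF.ge_zero (φ := fun y => G y - ε * penalty T y) (a := a (x, t) + m - ε)
    (b := b (x, t) - ε * (2 + 1 / (T - t) ^ 2)) hx hz.2
    ((hG.contDiffAt hz).sub (contDiffAt_const.mul (contDiffAt_penalty hzT)))
    (hd.congr_fderiv (by ext <;> simp))
    (hmax.neg.congr (Eventually.of_forall fun y => by simp only; ring))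
  have e := hG.equation hz
  have e1 := hG.slope_nonpos hz
  have e2 := hG.neg_le_slope hz
  simp only at e ⊢
  by_contra! hlt
  have h1 : F x t / x < G (x, t) / x := by gcongr
  have h2 : 0 < 1 / (T - t) ^ 2 := by positivity
  nlinarith [mul_pos hε h2, mul_nonneg hε.le (neg_le_iff_add_nonneg.1 e2),
    mul_nonneg hε.le (sub_nonneg.2 hε1), mul_nonneg hε.le (sub_nonneg.2 hm)]

/-- Uniqueness: the viscosity solution coincides with the classical one. -/
theorem eq_of_goodSolution (hm : m ≤ 1 / 2) {M : ℝ} (hM : ∀ x, 0 ≤ x → |F₀ x| ≤ M)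
    (hF : GoodSolution m F₀ F) (hz : z ∈ Ioi (0 : ℝ) ×ˢ Ioi (0 : ℝ)) : F z.1 z.2 = G z := by
  obtain ⟨⟨K, hK⟩, -, hFb, hF0, hsub, hsup⟩ := hF
  have hQ : Ioi (0 : ℝ) ×ˢ Ioi (0 : ℝ) ⊆ Ici (0 : ℝ) ×ˢ Ici (0 : ℝ) :=
    prod_mono Ioi_subset_Ici_self Ioi_subset_Ici_self
  have hFc : ContinuousOn (fun y : ℝ × ℝ => F y.1 y.2) (Ioi 0 ×ˢ Ioi 0) :=
    hK.continuousOn.mono hQ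
  have hGc : ContinuousOn G (Ioi 0 ×ˢ Ioi 0) := fun y hy =>
    (hG.contDiffAt hy).continuousAt.continuousWithinAt
  have hFt : ∀ y ∈ Ioi (0 : ℝ) ×ˢ Ioi (0 : ℝ), |F y.1 y.2 - F₀ y.1| ≤ K * y.2 := by
    rintro ⟨x, t⟩ hy
    have hy' := hQ hy
    have := hK.dist_le_mul (x, t) hy' (x, 0) ⟨hy'.1, self_mem_Ici⟩
    have ht : 0 < t := hy.2
    simpa [Real.dist_eq, Prod.dist_eq, hF0 x hy'.1, abs_of_pos ht, ht.le] using this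
  refine le_antisymm ?_ ?_ <;> by_contra! hlt
  · obtain ⟨ε, hε, T, y, hy, hyT, hpos, hmax⟩ := exists_isLocalMax_sub_penalty
      (D := fun y => F y.1 y.2 - G y) (L := K + 1) (M := M) (by positivity) (hFc.sub hGc)
      (fun y hy => by
        have := (hFb y.1 y.2 (hQ hy).1 (hQ hy).2).2
        have := hG.nonneg hy
        have hx : 0 < y.1 := hy.1
        nlinarith)
      (fun y hy => by
        have := (abs_le.1 (hFt y hy)).2
        have := (abs_le.1 (hG.abs_sub_le hy)).1
        linarith)
      (fun y hy => by
        have := (abs_le.1 (hFt y hy)).2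
        have := hG.nonneg hy
        have := (abs_le.1 (hM y.1 (hQ hy).1)).2
        have ht : 0 < y.2 := hy.2
        linarith) hz (sub_pos.2 hlt)
    have := hG.le_of_isSubsolution hm hsub hε.1 hy hyT hmax
    linarith
  · obtain ⟨ε, hε, T, y, hy, hyT, hpos, hmax⟩ := exists_isLocalMax_sub_penalty
      (D := fun y => G y - F y.1 y.2) (L := K + 1) (M := M) (by positivity) (hGc.sub hFc)
      (fun y hy => by
        have := (hFb y.1 y.2 (hQ hy).1 (hQ hy).2).1
        have := hG.le_mul hy
        have hx : 0 < y.1 := hy.1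
        nlinarith)
      (fun y hy => by
        have := (abs_le.1 (hFt y hy)).1
        have := (abs_le.1 (hG.abs_sub_le hy)).2
        linarith)
      (fun y hy => by
        have := (hFb y.1 y.2 (hQ hy).1 (hQ hy).2).1
        have := (abs_le.1 (hG.abs_sub_le hy)).2
        have := (abs_le.1 (hM y.1 (hQ hy).1)).2
        have ht : 0 < y.2 := hy.2
        have : 0 ≤ K * y.2 := by positivity
        linarith) hz (sub_pos.2 hlt)
    have := hG.le_of_isSupersolution hm hsup hε.1 hε.2 hy hyT hmax
    linarith

end IsClassicalSolution

namespace CharData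

variable {m : ℝ} {p v g : ℝ → ℝ} (h : CharData m p v g)

include h

theorem contDiffAt_label {ξ s : ℝ} (hξ : 0 < ξ) (hs : s ∈ Ioo (0 : ℝ) 2) {f : ℝ × ℝ → ℝ}
    (hf : ContDiffAt ℝ 1 f (ξ, s)) :
    ContDiffAt ℝ 1 (fun z => f (label p v z)) (flow p v (ξ, s)) := by
  rw [← h.label_flow (⟨hξ, hs⟩ : (ξ, s) ∈ Ioi (0 : ℝ) ×ˢ Ioo (0 : ℝ) 2)] at hf
  exact hf.comp _ (h.contDiffAt_label_flow hξ hs)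

theorem isClassicalSolution {F₀ : ℝ → ℝ} (hF₀ : ∀ x, 0 < x → HasDerivAt F₀ (p x + m) x)
    (hv : ∀ x, 0 < x → F₀ x = m * x + (v x + p x / 2) * x) :
    IsClassicalSolution m F₀ (charSol m p v) (fun z => slopeAt p v (label p v z))
      (fun z => -energyAt p v (label p v z)) := by
  constructor <;>
  · intro z hz
    obtain ⟨⟨ξ, s⟩, ⟨hξ, hs⟩, rfl⟩ := h.surjOn_flow hz
    have hξ' : 0 < ξ := hξ
    have hs' : s ∈ Ioo (0 : ℝ) 2 := hs
    have e := h.label_flow (⟨hξ, hs⟩ : (ξ, s) ∈ Ioi (0 : ℝ) ×ˢ Ioo (0 : ℝ) 2)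
    have hb := h.flowValue_bounds hξ' hs'.1.le hs'.2
    have h1 := h.neg_le_slopeAt hξ' hs'.1.le hs'.2
    have hX := h.flow_fst_pos hξ' hs'.1.le hs'.2
    try simp only [charSol, e]
    first
      | exact h.contDiffAt_label hξ' hs' (h.contDiffAt_flowValue hξ')
      | exact h.hasFDerivAt_charSol_flow hξ' hs'
      | exact h.flowValue_equation hξ' hs'.1.le hs'.2
      | exact h1
      | exact h.slopeAt_nonpos hξ' hs'.1.le hs'.2
      | exact h.abs_flowValue_sub_le hF₀ hv hξ' hs'.1.le hs'.2
      | exact hb.2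
      | exact (mul_nonneg (by linarith) hX.le).trans hb.1

theorem contDiffAt_slopeAt_label {z : ℝ × ℝ} (hz : z ∈ Ioi (0 : ℝ) ×ˢ Ioi (0 : ℝ)) :
    ContDiffAt ℝ 1 (fun z => slopeAt p v (label p v z)) z := by
  obtain ⟨⟨ξ, s⟩, ⟨hξ, hs⟩, rfl⟩ := h.surjOn_flow hz
  exact h.contDiffAt_label hξ hs (h.contDiffAt_slopeAt hξ (le_of_lt hs.1) hs.2)

theorem contDiffAt_energyAt_label {z : ℝ × ℝ} (hz : z ∈ Ioi (0 : ℝ) ×ˢ Ioi (0 : ℝ)) :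
    ContDiffAt ℝ 1 (fun z => -energyAt p v (label p v z)) z := by
  obtain ⟨⟨ξ, s⟩, ⟨hξ, hs⟩, rfl⟩ := h.surjOn_flow hz
  exact (h.contDiffAt_label hξ hs (h.contDiffAt_energyAt hξ)).neg

theorem hasFDerivAt_slopeAt {ξ s : ℝ} (hξ : 0 < ξ) (hs : 0 ≤ s) (hs2 : s < 2) :
    HasFDerivAt (slopeAt p v)
      (((1 - s / 2) * (g ξ + (p ξ * g ξ + (p ξ - g ξ) / 2 - v ξ) * charT (p ξ) (v ξ) s)
          / (ξ * charY (p ξ) (v ξ) s)) • ContinuousLinearMap.fst ℝ ℝ ℝ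
        + ((v ξ * (1 - s / 2) - charYd (p ξ) (v ξ) s / 2) / charY (p ξ) (v ξ) s) •
          ContinuousLinearMap.snd ℝ ℝ ℝ) (ξ, s) := by
  have hY := (h.admissible hξ).charY_pos hs hs2
  refine ((h.contDiffAt_slopeAt hξ hs hs2).hasStrictFDerivAt_of_partial ?_ ?_).hasFDerivAt
  · have key := ((h.hasDerivAt_mul_charYd s hξ).div (h.hasDerivAt_mul_charY s hξ)
      (mul_pos hξ hY).ne').const_mul (1 - s / 2)
    have e := varYd_sub (g := g ξ) (h.admissible hξ) hs hs2
    refine (key.congr_deriv ?_).congr_of_eventuallyEq ?_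
    · rw [← e]
      field_simp
    · filter_upwards [Ioi_mem_nhds hξ] with x hx
      simp only [slopeAt, Pi.div_apply]
      rw [mul_div_mul_left _ _ (ne_of_gt hx)]
  · refine ((hasDerivAt_one_sub_half s).mul (_root_.hasDerivAt_slope hY.ne')).congr_deriv ?_
    field_simp
    ring

/-- The second space derivative of the solution, along the characteristic flow. -/
theorem hasDerivAt_slopeAt_label {ξ s : ℝ} (hξ : 0 < ξ) (hs : s ∈ Ioo (0 : ℝ) 2) :
    HasDerivAt (fun y => slopeAt p v (label p v (y, (flow p v (ξ, s)).2)))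
      ((1 - s / 2) * jacDeriv (p ξ) (v ξ) (g ξ) s / jac (p ξ) (v ξ) (g ξ) s
        / (flow p v (ξ, s)).1) (flow p v (ξ, s)).1 := by
  have hY := ((h.admissible hξ).charY_pos hs.1.le hs.2).ne'
  have hJ := (h.jac_pos hξ hs.1.le hs.2).ne'
  have hσ : 1 - s / 2 ≠ 0 := by linarith [hs.2]
  have h1 := (h.hasStrictFDerivAt_label hξ hs).hasFDerivAt
  have h2 := h.hasFDerivAt_slopeAt hξ hs.1.le hs.2
  rw [← h.label_flow (⟨hξ, hs⟩ : (ξ, s) ∈ Ioi (0 : ℝ) ×ˢ Ioo (0 : ℝ) 2)] at h2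
  have h3 : HasDerivAt (fun y => (y, (flow p v (ξ, s)).2)) ((1 : ℝ), (0 : ℝ))
      (flow p v (ξ, s)).1 := (hasDerivAt_id _).prodMk (hasDerivAt_const _ _)
  refine ((h2.comp _ h1).comp_hasDerivAt (flow p v (ξ, s)).1 h3).congr_deriv ?_
  simp only [ContinuousLinearMap.comp_apply, ContinuousLinearEquiv.coe_coe,
    planeEquiv_symm_apply, h.det_eq hξ hs.1.le hs.2]
  simp [flow, jacDeriv]
  clear h1 h2 h3
  generalize 1 - s / 2 = σ at *
  field_simp
  ring

theorem tendsto_slopeAt_label {t : ℝ} (ht : 0 < t) :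
    Tendsto (fun z => slopeAt p v (label p v z)) (nhdsWithin (0, t) (Ioi 0 ×ˢ Ioi 0)) (nhds 0) ∧
    Tendsto (fun z => -energyAt p v (label p v z)) (nhdsWithin (0, t) (Ioi 0 ×ˢ Ioi 0))
      (nhds 0) := by
  have hm2 := h.lt_half
  have hR : ContinuousAt (fun z : ℝ × ℝ => 2 * z.1 / z.2) (0, t) :=
    (continuousAt_const.mul continuousAt_fst).div continuousAt_snd ht.ne'
  have h1 : Tendsto (fun z : ℝ × ℝ => (2 * z.1 / z.2) ^ ((1 - 2 * m) / 2))
      (nhdsWithin (0, t) (Ioi 0 ×ˢ Ioi 0)) (nhds 0) := by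
    have := (hR.rpow_const (p := (1 - 2 * m) / 2) (Or.inr (by linarith))).continuousWithinAt
      (s := Ioi 0 ×ˢ Ioi 0)
    simpa [ContinuousWithinAt, Real.zero_rpow (by linarith : (1 - 2 * m) / 2 ≠ 0)] using this
  have h2 : Tendsto (fun z : ℝ × ℝ => (2 * z.1 / z.2) / 4)
      (nhdsWithin (0, t) (Ioi 0 ×ˢ Ioi 0)) (nhds 0) := by
    simpa [ContinuousWithinAt] using (hR.div_const 4).continuousWithinAt (s := Ioi 0 ×ˢ Ioi 0)
  have key : ∀ {ξ s : ℝ}, 0 < ξ → s ∈ Ioo (0 : ℝ) 2 →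
      (1 - s / 2) ^ 2 ≤ 2 * (flow p v (ξ, s)).1 / (flow p v (ξ, s)).2 := by
    intro ξ s hξ hs
    have hT : 0 < (flow p v (ξ, s)).2 := (h.flow_mem hξ hs).2
    have h3 := h.le_flow_fst hξ hs.1.le hs.2
    have h4 := h.flow_snd_le hξ hs.1.le hs.2.le
    rw [le_div_iff₀ hT]
    have h5 : (flow p v (ξ, s)).2 ≤ 2 * ξ := by nlinarith [hs.2]
    nlinarith [mul_le_mul_of_nonneg_left h5 (sq_nonneg (1 - s / 2))]
  constructor
  · refine squeeze_zero_norm' ?_ h1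
    filter_upwards [self_mem_nhdsWithin] with z hz
    obtain ⟨⟨ξ, s⟩, ⟨hξ, hs⟩, rfl⟩ := h.surjOn_flow hz
    have hξ' : 0 < ξ := hξ
    have hs' : s ∈ Ioo (0 : ℝ) 2 := hs
    rw [h.label_flow ⟨hξ, hs⟩, Real.norm_of_nonpos (h.slopeAt_nonpos hξ' hs'.1.le hs'.2)]
    have hσ : 0 < 1 - s / 2 := by linarith [hs'.2]
    have h3 := (h.admissible hξ').neg_rpow_le_slope hs'.1.le hs'.2
    have h4 := h.neg_le_slope hξ'
    calc -slopeAt p v (ξ, s) ≤ (1 - s / 2) ^ (1 + 2 * p ξ) := neg_le.1 h3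
      _ ≤ (1 - s / 2) ^ (1 - 2 * m) :=
        Real.rpow_le_rpow_of_exponent_ge hσ (by linarith [hs'.1]) (by linarith)
      _ = ((1 - s / 2) ^ 2) ^ ((1 - 2 * m) / 2) := by
        rw [← Real.rpow_natCast, ← Real.rpow_mul hσ.le]
        congr 1
        push_cast
        ring
      _ ≤ _ := Real.rpow_le_rpow (sq_nonneg _) (key hξ' hs') (by linarith)
  · refine squeeze_zero_norm' ?_ h2
    filter_upwards [self_mem_nhdsWithin] with z hz
    obtain ⟨⟨ξ, s⟩, ⟨hξ, hs⟩, rfl⟩ := h.surjOn_flow hz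
    rw [h.label_flow ⟨hξ, hs⟩, norm_neg, Real.norm_eq_abs]
    refine (h.abs_energyAt_le hξ).trans ?_
    have := key hξ hs
    gcongr

end CharData

/-- A function on the closed quadrant, differentiable inside with continuous derivative converging
to a constant at the edge `x = 0`, is `C¹` up to this edge. -/
theorem contDiffOn_one_Ici_prod_Ioi {f : ℝ × ℝ → ℝ} {f' : ℝ × ℝ → ℝ × ℝ →L[ℝ] ℝ}
    {c : ℝ × ℝ →L[ℝ] ℝ} (hc : ContinuousOn f (Ici 0 ×ˢ Ici 0))
    (hf : ∀ z ∈ Ioi (0 : ℝ) ×ˢ Ioi (0 : ℝ), HasFDerivAt f (f' z) z)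
    (hf' : ContinuousOn f' (Ioi 0 ×ˢ Ioi 0))
    (h0 : ∀ t, 0 < t → Tendsto f' (nhdsWithin (0, t) (Ioi 0 ×ˢ Ioi 0)) (nhds c)) :
    ContDiffOn ℝ 1 f (Ici 0 ×ˢ Ioi 0) := by
  have hopen : IsOpen (Ioi (0 : ℝ) ×ˢ Ioi (0 : ℝ)) := isOpen_Ioi.prod isOpen_Ioi
  have hconv : Convex ℝ (Ioi (0 : ℝ) ×ˢ Ioi (0 : ℝ)) := (convex_Ioi 0).prod (convex_Ioi 0)
  have hcl : closure (Ioi (0 : ℝ) ×ˢ Ioi (0 : ℝ)) = Ici 0 ×ˢ Ici 0 := by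
    rw [closure_prod_eq, closure_Ioi]
  have hu : UniqueDiffOn ℝ (Ici (0 : ℝ) ×ˢ Ioi (0 : ℝ)) :=
    (uniqueDiffOn_Ici 0).prod (uniqueDiffOn_Ioi 0)
  rw [← zero_add (1 : WithTop ℕ∞), contDiffOn_succ_iff_hasFDerivWithinAt_of_uniqueDiffOn hu]
  classical
  refine ⟨by simp, fun z => if 0 < z.1 then f' z else c, contDiffOn_zero.2 ?_, ?_⟩
  · rintro ⟨x, t⟩ ⟨hx, ht⟩
    rcases (mem_Ici.1 hx).lt_or_eq with hx | rfl
    · refine (((hf' _ ⟨hx, ht⟩).continuousAt (hopen.mem_nhds ⟨hx, ht⟩)).congr ?_).continuousWithinAt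
      filter_upwards [hopen.mem_nhds (⟨hx, ht⟩ : (x, t) ∈ Ioi (0 : ℝ) ×ˢ Ioi (0 : ℝ))] with y hy
      exact (if_pos hy.1).symm
    · rw [ContinuousWithinAt, if_neg (lt_irrefl _)]
      refine ((h0 t ht).mono_left ?_).if tendsto_const_nhds
      rw [nhdsWithin, nhdsWithin, inf_assoc, inf_principal]
      exact inf_le_inf_left _ (principal_mono.2 fun y hy => ⟨hy.2, hy.1.2⟩)
  · rintro ⟨x, t⟩ ⟨hx, ht⟩
    rcases (mem_Ici.1 hx).lt_or_eq with hx | rfl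
    · simp only [if_pos hx]
      exact (hf _ ⟨hx, ht⟩).hasFDerivWithinAt
    · simp only [if_neg (lt_irrefl (0 : ℝ))]
      refine (hasFDerivWithinAt_closure_of_tendsto_fderiv
        (fun y hy => (hf y hy).differentiableAt.differentiableWithinAt) hconv hopen
        (fun y hy => (hc y (hcl ▸ hy)).mono (hcl ▸ subset_closure))
        ((h0 t ht).congr' ?_)).mono ?_
      · filter_upwards [self_mem_nhdsWithin] with y hy using (hf y hy).fderiv.symm
      · rw [hcl]
        exact prod_mono le_rfl Ioi_subset_Ici_self

/-- Theorem 1.6, `C^{1,1}` regularity for `0 < m < 1/2`.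
Under (A1)–(A3), the Lipschitz sublinear viscosity solution `F` of (HJ) is
`C^{1,1}((0,∞)²) ∩ C¹([0,∞)×(0,∞))`, with `0 ≤ ∂ₓF ≤ m` and
`−1 ≤ x·∂ₓ²F ≤ 0` wherever the second `x`-derivative exists. -/
theorem regularity_m_less_half (m : ℝ) (hm₀ : 0 < m) (hm₁ : m < 1 / 2)
    (F₀ : ℝ → ℝ) (hC2 : ContDiffOn ℝ 2 F₀ (Ici 0))
    (hBdd : ∃ M : ℝ, ∀ x : ℝ, 0 ≤ x → |F₀ x| ≤ M)
    (hBd : ∀ x : ℝ, 0 ≤ x → 0 ≤ F₀ x ∧ F₀ x ≤ m * x)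
    (hA1 : (∀ x : ℝ, 0 ≤ x → 0 ≤ D1 F₀ x ∧ D1 F₀ x ≤ m) ∧ D1 F₀ 0 = m)
    (hA2 : ∃ C > 0, ∀ x : ℝ, 0 < x → -C ≤ D2 F₀ x ∧ D2 F₀ x ≤ 0)
    (hA3 : (∀ x : ℝ, 0 < x → -(m / Real.exp 1) ≤ x * D2 F₀ x ∧ x * D2 F₀ x ≤ 0) ∧
      ∃ β ∈ Ioo (0 : ℝ) 1, ∃ C > 0,
        (∀ x : ℝ, 0 ≤ x → |x * D2 F₀ x| ≤ C) ∧
        (∀ x y : ℝ, 0 ≤ x → 0 ≤ y → |x * D2 F₀ x - y * D2 F₀ y| ≤ C * |x - y| ^ β))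
    (F : ℝ → ℝ → ℝ) (hF : GoodSolution m F₀ F) :
    -- `F ∈ C¹((0,∞)×(0,∞))` with locally Lipschitz derivative (`C^{1,1}`):
    ContDiffOn ℝ 1 (fun p : ℝ × ℝ => F p.1 p.2) (Ioi 0 ×ˢ Ioi 0) ∧
    (∀ p ∈ (Ioi (0 : ℝ) ×ˢ Ioi (0 : ℝ)), ∃ ε > 0, ∃ L : NNReal,
      LipschitzOnWith L (fderiv ℝ (fun p : ℝ × ℝ => F p.1 p.2)) (Metric.ball p ε)) ∧
    -- `F ∈ C¹([0,∞)×(0,∞))`: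
    ContDiffOn ℝ 1 (fun p : ℝ × ℝ => F p.1 p.2) (Ici 0 ×ˢ Ioi 0) ∧
    -- gradient bound:
    (∀ x t : ℝ, 0 < x → 0 < t →
      0 ≤ deriv (fun y => F y t) x ∧ deriv (fun y => F y t) x ≤ m) ∧
    -- second derivative bound wherever the second derivative in `x` exists:
    (∀ x t : ℝ, 0 < x → 0 < t → ∀ q : ℝ,
      HasDerivAt (fun y => deriv (fun z => F z t) y) q x →
      -1 ≤ x * q ∧ x * q ≤ 0) := by
  obtain ⟨M, hM⟩ := hBdd
  have hch := charData_of_initial hm₀ hm₁ hC2 hBd hA1.1 hA3.1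
  have hG := hch.isClassicalSolution (F₀ := F₀)
    (fun x hx => by simpa only [sub_add_cancel] using hasDerivAt_of_contDiffOn_two hC2 hx)
    (fun x hx => by field_simp; ring)
  have hopen : IsOpen (Ioi (0 : ℝ) ×ˢ Ioi (0 : ℝ)) := isOpen_Ioi.prod isOpen_Ioi
  have heq : ∀ z ∈ Ioi (0 : ℝ) ×ˢ Ioi (0 : ℝ), F z.1 z.2 = charSol m _ _ z :=
    fun z hz => hG.eq_of_goodSolution hm₁.le hM hF hz
  generalize hp : (fun ξ => D1 F₀ ξ - m) = p at *
  generalize hv : (fun ξ => F₀ ξ / ξ - m - (D1 F₀ ξ - m) / 2) = v at *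
  have hd : ∀ z ∈ Ioi (0 : ℝ) ×ˢ Ioi (0 : ℝ), HasFDerivAt (fun y : ℝ × ℝ => F y.1 y.2)
      ((slopeAt p v (label p v z) + m) • ContinuousLinearMap.fst ℝ ℝ ℝ
        + (-energyAt p v (label p v z)) • ContinuousLinearMap.snd ℝ ℝ ℝ) z := fun z hz =>
    (hG.hasFDerivAt hz).congr_of_eventuallyEq
      (eventually_of_mem (hopen.mem_nhds hz) heq)
  have hdc : ∀ z ∈ Ioi (0 : ℝ) ×ˢ Ioi (0 : ℝ), ContDiffAt ℝ 1 (fun z =>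
      (slopeAt p v (label p v z) + m) • ContinuousLinearMap.fst ℝ ℝ ℝ
        + (-energyAt p v (label p v z)) • ContinuousLinearMap.snd ℝ ℝ ℝ) z := fun z hz =>
    (((hch.contDiffAt_slopeAt_label hz).add contDiffAt_const).smul contDiffAt_const).add
      ((hch.contDiffAt_energyAt_label hz).smul contDiffAt_const)
  have hdx : ∀ x t : ℝ, 0 < x → 0 < t →
      HasDerivAt (fun y => F y t) (slopeAt p v (label p v (x, t)) + m) x := fun x t hx ht =>
    (hd (x, t) ⟨hx, ht⟩).hasDerivAt_fst
  have hC1 : ContDiffOn ℝ 1 (fun z : ℝ × ℝ => F z.1 z.2) (Ici 0 ×ˢ Ioi 0) := by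
    refine contDiffOn_one_Ici_prod_Ioi (c := (0 + m) • ContinuousLinearMap.fst ℝ ℝ ℝ
      + (0 : ℝ) • ContinuousLinearMap.snd ℝ ℝ ℝ) hF.1.choose_spec.continuousOn hd
      (fun z hz => (hdc z hz).continuousAt.continuousWithinAt) fun t ht => ?_
    obtain ⟨h1, h2⟩ := hch.tendsto_slopeAt_label ht
    exact ((h1.add_const m).smul_const _).add (h2.smul_const _)
  refine ⟨hC1.mono (prod_mono Ioi_subset_Ici_self le_rfl), fun z hz => ?_, hC1,
    fun x t hx ht => ?_, fun x t hx ht q hq => ?_⟩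
  · obtain ⟨L, u, hu, hL⟩ := (hdc z hz).exists_lipschitzOnWith
    obtain ⟨ε, hε, hball⟩ := Metric.mem_nhds_iff.1 (inter_mem hu (hopen.mem_nhds hz))
    refine ⟨ε, hε, L, fun y hy w hw => ?_⟩
    rw [(hd y (hball hy).2).fderiv, (hd w (hball hw).2).fderiv]
    exact hL (hball hy).1 (hball hw).1
  · rw [(hdx x t hx ht).deriv]
    have h1 := hG.neg_le_slope (z := (x, t)) ⟨hx, ht⟩
    have h2 := hG.slope_nonpos (z := (x, t)) ⟨hx, ht⟩
    constructor <;> linarith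
  · obtain ⟨⟨ξ, s⟩, ⟨hξ, hs⟩, he⟩ := hch.surjOn_flow
      (⟨hx, ht⟩ : (x, t) ∈ Ioi (0 : ℝ) ×ˢ Ioi (0 : ℝ))
    have key := hch.hasDerivAt_slopeAt_label hξ hs
    rw [he] at key
    have hq' := hq.congr_of_eventuallyEq (f₁ := fun y => slopeAt p v (label p v (y, t)) + m)
      (by filter_upwards [Ioi_mem_nhds hx] with y hy using (hdx y t hy ht).deriv.symm)
    have e := hq'.unique (key.add_const m)
    have hJ := hch.jac_pos hξ (le_of_lt hs.1) hs.2
    have hN := jacDeriv_nonpos (hch.admissible hξ) (hch.neg_one_le hξ) (hch.nonpos hξ)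
      (le_of_lt hs.1) hs.2
    have hNJ := jacDeriv_add_jac_nonneg (hch.admissible hξ) (hch.neg_one_le hξ)
      (le_of_lt hs.1) hs.2
    have hσ : 0 < 1 - s / 2 := by
      have : s < 2 := hs.2
      linarith
    rw [e, mul_div_cancel₀ _ hx.ne', le_div_iff₀ hJ, div_le_iff₀ hJ]
    constructor
    · linarith
    · rw [zero_mul]
      exact mul_nonpos_of_nonneg_of_nonpos hσ.le hN
end

section
/- Let ε > 0, 0 < m ≤ 1, and let F₀ ∈ C²([0,∞)) be Lipschitz and sublinear with 0 ≤ F₀(x) ≤ m·x, satisfying (A1) and (A2). Let F be continuous on [0,∞)×[0,∞), smooth on (0,∞)×(0,∞), twice continuously differentiable in x and once in t up to the boundary x = 0 for t > 0, globally Lipschitz in x, with 0 ≤ F(x,t) ≤ m·x, solving ∂_t F + (1/2)(∂_x F − m)(∂_x F − m − 1) + F/x − m = ε·∂_x² F pointwise on (0,∞)×(0,∞), with F(x,0) = F₀(x) and F(0,t) = 0. Then 0 ≤ ∂_x F(x,t) ≤ m for all (x,t) ∈ [0,∞)×(0,∞). -/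
open Set Filter

/-- Partial derivative of `F` in the spatial variable `x`, taken within `[0,∞)`. -/
noncomputable def pX (F : ℝ → ℝ → ℝ) (x t : ℝ) : ℝ :=
  derivWithin (fun y => F y t) (Ici 0) x

/-- Second partial derivative of `F` in `x`, taken within `[0,∞)`. -/
noncomputable def pXX (F : ℝ → ℝ → ℝ) (x t : ℝ) : ℝ :=
  derivWithin (fun y => pX F y t) (Ici 0) x

/-- Partial derivative of `F` in the time variable `t`. -/
noncomputable def pT (F : ℝ → ℝ → ℝ) (x t : ℝ) : ℝ :=
  deriv (fun s => F x s) t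

/-- A local maximum satisfies the first- and second-order necessary conditions. -/
theorem IsLocalMax.hasDerivAt_eq_zero_and_nonpos {f f' : ℝ → ℝ} {f'' x : ℝ}
    (hmax : IsLocalMax f x) (hf : ∀ᶠ z in nhds x, HasDerivAt f (f' z) z)
    (hf' : HasDerivAt f' f'' x) : f' x = 0 ∧ f'' ≤ 0 := by
  have h1 : f' x = 0 := hmax.hasDerivAt_eq_zero hf.self_of_nhds
  have hd : deriv f =ᶠ[nhds x] f' := hf.mono fun z hz => hz.deriv
  have hdd : deriv (deriv f) x = f'' := hd.deriv_eq.trans hf'.deriv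
  refine ⟨h1, ?_⟩
  by_contra! hpos
  have hmin : IsLocalMin f x :=
    isLocalMin_of_deriv_deriv_pos (hdd ▸ hpos) (hd.self_of_nhds.trans h1)
      hf.self_of_nhds.continuousAt
  have hconst : f =ᶠ[nhds x] fun _ => f x := by
    filter_upwards [hmax, hmin] with z h h' using le_antisymm h h'
  have h0 : deriv f =ᶠ[nhds x] fun _ => 0 := by
    simpa using hconst.deriv
  have : deriv (deriv f) x = 0 := by simpa using h0.deriv_eq
  linarith

/-- The derivative is nonnegative at a maximum from the left. -/
theorem HasDerivAt.nonneg_of_eventually_le_left {f : ℝ → ℝ} {f' t : ℝ} (hf : HasDerivAt f f' t)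
    (h : ∀ᶠ s in nhdsWithin t (Iio t), f s ≤ f t) : 0 ≤ f' := by
  have h1 := (hasDerivWithinAt_iff_tendsto_slope' (by simp)).1 (hf.hasDerivWithinAt (s := Iio t))
  refine ge_of_tendsto h1 ?_
  filter_upwards [h, self_mem_nhdsWithin] with s hs hst
  rw [slope_def_field]
  exact div_nonneg_of_nonpos (by linarith) (by linarith [mem_Iio.1 hst])

/-- If `A x t + B y t` is positive somewhere on `0 ≤ x ≤ y`, `0 ≤ t`, but nonpositive on the
parabolic boundary of this region, then up to a given time it has a positive maximum off
that boundary. -/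
theorem exists_interior_max_of_pos {A B : ℝ → ℝ → ℝ} {R : ℝ}
    (hA : ContinuousOn (fun p : ℝ × ℝ => A p.1 p.2) (Ici 0 ×ˢ Ici 0))
    (hB : ContinuousOn (fun p : ℝ × ℝ => B p.1 p.2) (Ici 0 ×ˢ Ici 0))
    (hleft : ∀ y t, 0 ≤ y → 0 ≤ t → A 0 t + B y t ≤ 0)
    (hdiag : ∀ x t, 0 ≤ x → 0 ≤ t → A x t + B x t ≤ 0)
    (hinit : ∀ x y, 0 ≤ x → x ≤ y → A x 0 + B y 0 ≤ 0)
    (hR : ∀ x y t, 0 ≤ x → x ≤ y → R ≤ y → 0 ≤ t → A x t + B y t ≤ 0)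
    {x₀ y₀ T : ℝ} (hx₀ : 0 ≤ x₀) (hxy₀ : x₀ ≤ y₀) (hT : 0 ≤ T) (hpos : 0 < A x₀ T + B y₀ T) :
    ∃ x y t, 0 < x ∧ x < y ∧ 0 < t ∧ 0 < A x t + B y t ∧
      IsLocalMax (fun z => A z t) x ∧ IsLocalMax (fun z => B z t) y ∧
      ∀ᶠ s in nhdsWithin t (Iio t), A x s + B y s ≤ A x t + B y t := by
  let S : Set (ℝ × ℝ × ℝ) :=
    {p | 0 ≤ p.1 ∧ p.1 ≤ p.2.1 ∧ p.2.1 ≤ R ∧ 0 ≤ p.2.2 ∧ p.2.2 ≤ T}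
  have hSc : IsCompact S := by
    refine (isCompact_Icc.prod (isCompact_Icc.prod isCompact_Icc) :
      IsCompact (Icc 0 R ×ˢ (Icc 0 R ×ˢ Icc 0 T))).of_isClosed_subset ?_ ?_
    · simp only [S, ofPred_and]
      refine IsClosed.inter ?_ (IsClosed.inter ?_ (IsClosed.inter ?_ (IsClosed.inter ?_ ?_))) <;>
        exact isClosed_le (by fun_prop) (by fun_prop)
    · rintro ⟨x, y, t⟩ ⟨h1, h2, h3, h4, h5⟩
      simp only at h1 h2 h3 h4 h5
      exact ⟨⟨h1, h2.trans h3⟩, ⟨h1.trans h2, h3⟩, h4, h5⟩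
  have hy₀ : y₀ < R := by
    by_contra! h
    linarith [hR x₀ y₀ T hx₀ hxy₀ h hT]
  have hmem : (x₀, y₀, T) ∈ S := ⟨hx₀, hxy₀, hy₀.le, hT, le_rfl⟩
  have hcont : ContinuousOn (fun p : ℝ × ℝ × ℝ => A p.1 p.2.2 + B p.2.1 p.2.2) S := by
    refine ContinuousOn.add
      (hA.comp (f := fun p : ℝ × ℝ × ℝ => (p.1, p.2.2)) (by fun_prop) ?_)
      (hB.comp (f := fun p : ℝ × ℝ × ℝ => (p.2.1, p.2.2)) (by fun_prop) ?_)
    · exact fun p hp => ⟨hp.1, hp.2.2.2.1⟩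
    · exact fun p hp => ⟨hp.1.trans hp.2.1, hp.2.2.2.1⟩
  obtain ⟨⟨x, y, t⟩, ⟨h1, h2, h3, h4, h5⟩, hmax⟩ := hSc.exists_isMaxOn ⟨_, hmem⟩ hcont
  simp only at h1 h2 h3 h4 h5
  have hval : 0 < A x t + B y t := hpos.trans_le (hmax hmem)
  have hx : 0 < x := h1.lt_of_ne' fun h => by
    subst h
    linarith [hleft y t h2 h4]
  have hxy : x < y := h2.lt_of_ne fun h => by
    subst h
    linarith [hdiag x t h1 h4]
  have hyR : y < R := by
    by_contra! h
    linarith [hR x y t h1 h2 h h4]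
  have ht : 0 < t := h4.lt_of_ne' fun h => by
    subst h
    linarith [hinit x y h1 h2]
  refine ⟨x, y, t, hx, hxy, ht, hval, ?_, ?_, ?_⟩
  · filter_upwards [Ioo_mem_nhds hx hxy] with z hz
    have : A z t + B y t ≤ A x t + B y t :=
      hmax (show (z, y, t) ∈ S from ⟨hz.1.le, hz.2.le, h3, h4, h5⟩)
    linarith
  · filter_upwards [Ioo_mem_nhds hxy hyR] with z hz
    have : A x t + B z t ≤ A x t + B y t :=
      hmax (show (x, z, t) ∈ S from ⟨h1, hz.1.le, hz.2.le, h4, h5⟩)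
    linarith
  · filter_upwards [Ioo_mem_nhdsLT ht] with s hs
    exact hmax (show (x, y, s) ∈ S from ⟨h1, h2, h3, hs.1.le, hs.2.le.trans h5⟩)

/-- On the open half-line the one-sided first derivative is an honest derivative. -/
theorem hasDerivAt_pX {F : ℝ → ℝ → ℝ} {t x : ℝ}
    (h : ContDiffOn ℝ 2 (fun x => F x t) (Ici 0)) (hx : 0 < x) :
    HasDerivAt (fun z => F z t) (pX F x t) x :=
  ((h.differentiableOn (by norm_num) x hx.le).hasDerivWithinAt).hasDerivAt (Ici_mem_nhds hx)

/-- On the open half-line the one-sided second derivative is an honest derivative. -/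
theorem hasDerivAt_pXX {F : ℝ → ℝ → ℝ} {t x : ℝ}
    (h : ContDiffOn ℝ 2 (fun x => F x t) (Ici 0)) (hx : 0 < x) :
    HasDerivAt (fun z => pX F z t) (pXX F x t) x := by
  have h1 : ContDiffOn ℝ 1 (fun z => pX F z t) (Ici 0) :=
    h.derivWithin (uniqueDiffOn_Ici 0) (by norm_num)
  exact ((h1.differentiableOn (by norm_num) x hx.le).hasDerivWithinAt).hasDerivAt (Ici_mem_nhds hx)

theorem hasDerivAt_pT {F : ℝ → ℝ → ℝ} {x t : ℝ}
    (h : ContDiffOn ℝ 1 (fun s => F x s) (Ioi 0)) (ht : 0 < t) :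
    HasDerivAt (fun s => F x s) (pT F x t) t :=
  ((h.differentiableOn (by norm_num) t ht).differentiableAt (Ioi_mem_nhds ht)).hasDerivAt

/-- The solution stays nondecreasing in `x`, up to an arbitrarily small quadratic error. -/
theorem sub_le_error_of_viscous {ε m δ lam : ℝ} (hε : 0 < ε) (hm₀ : 0 < m) (hδ : 0 < δ)
    {F : ℝ → ℝ → ℝ}
    (hcont : ContinuousOn (fun p : ℝ × ℝ => F p.1 p.2) (Ici 0 ×ˢ Ici 0))
    (hx_reg : ∀ t : ℝ, 0 < t → ContDiffOn ℝ 2 (fun x => F x t) (Ici 0))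
    (ht_reg : ∀ x : ℝ, 0 ≤ x → ContDiffOn ℝ 1 (fun s => F x s) (Ioi 0))
    {K : NNReal} (hK : ∀ t : ℝ, 0 ≤ t → LipschitzOnWith K (fun x => F x t) (Ici 0))
    (hbd : ∀ x t : ℝ, 0 ≤ x → 0 ≤ t → 0 ≤ F x t ∧ F x t ≤ m * x)
    (hPDE : ∀ x t : ℝ, 0 < x → 0 < t →
      pT F x t + (1 / 2) * (pX F x t - m) * (pX F x t - m - 1) + F x t / x - m =
        ε * pXX F x t)
    (hmono : MonotoneOn (fun x => F x 0) (Ici 0))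
    (hlam : lam = K + 2 * m + 1 + 2 * ε)
    {x y t : ℝ} (hx : 0 ≤ x) (hxy : x ≤ y) (ht : 0 ≤ t) :
    F x t - F y t ≤ δ * Real.exp (lam * t) * (1 + y ^ 2) := by
  have hlam0 : 0 < lam := by rw [hlam]; positivity
  by_contra! hcon
  obtain ⟨x, y, t, hx, hxy, ht, hval, hA, hB, hT⟩ := exists_interior_max_of_pos
    (A := F) (B := fun y t => -F y t - δ * Real.exp (lam * t) * (1 + y ^ 2)) (R := m / δ)
    hcont (by fun_prop)
    (fun y t hy ht => by
      have h1 := hbd 0 t le_rfl ht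
      have h2 := hbd y t hy ht
      have : 0 ≤ δ * Real.exp (lam * t) * (1 + y ^ 2) := by positivity
      linarith)
    (fun x t hx ht => by
      have : 0 ≤ δ * Real.exp (lam * t) * (1 + x ^ 2) := by positivity
      linarith)
    (fun x y hx hxy => by
      have h1 : F x 0 ≤ F y 0 := hmono hx (hx.trans hxy) hxy
      have : 0 ≤ δ * Real.exp (lam * 0) * (1 + y ^ 2) := by positivity
      linarith)
    (fun x y t hx hxy hy ht => by
      have h1 := hbd x t hx ht
      have h2 := hbd y t (hx.trans hxy) ht
      have h3 : m ≤ y * δ := (div_le_iff₀ hδ).1 hy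
      have h4 : δ * 1 * (1 + y ^ 2) ≤ δ * Real.exp (lam * t) * (1 + y ^ 2) := by
        gcongr
        exact Real.one_le_exp (by positivity)
      have hy0 := hx.trans hxy
      nlinarith)
    (x₀ := x) (y₀ := y) (T := t) hx hxy ht (by linarith)
  have hy := hx.trans hxy
  set E := δ * Real.exp (lam * t) with hE
  have hEpos : 0 < E := by positivity
  have hxr := hx_reg t ht
  obtain ⟨a1, a2⟩ := hA.hasDerivAt_eq_zero_and_nonpos
    ((eventually_gt_nhds hx).mono fun z hz => hasDerivAt_pX hxr hz) (hasDerivAt_pXX hxr hx)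
  obtain ⟨b1, b2⟩ := hB.hasDerivAt_eq_zero_and_nonpos
    (f' := fun z => -pX F z t - E * (2 * z)) (f'' := -pXX F y t - E * 2)
    ((eventually_gt_nhds hy).mono fun z hz => by
      have := ((hasDerivAt_pow 2 z).const_add 1).const_mul E
      simpa using (hasDerivAt_pX hxr hz).fun_neg.fun_sub this)
    (by
      have := ((hasDerivAt_id' y).const_mul 2).const_mul E
      simpa using (hasDerivAt_pXX hxr hy).fun_neg.fun_sub this)
  have hexp : HasDerivAt (fun s => δ * Real.exp (lam * s) * (1 + y ^ 2))
      (lam * (E * (1 + y ^ 2))) t :=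
    (((((hasDerivAt_id' t).const_mul lam).exp).const_mul δ).mul_const (1 + y ^ 2)).congr_deriv
      (by rw [hE]; ring)
  have c := ((hasDerivAt_pT (ht_reg x hx.le) ht).fun_add
    ((hasDerivAt_pT (ht_reg y hy.le) ht).fun_neg.fun_sub hexp)).nonneg_of_eventually_le_left hT
  have hKy : |pX F y t| ≤ K := by
    have := norm_deriv_le_of_lipschitzOn (Ici_mem_nhds hy) (hK t ht.le)
    rwa [(hasDerivAt_pX hxr hy).deriv, Real.norm_eq_abs] at this
  have e1 := hPDE x t hx ht
  have e2 := hPDE y t hy ht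
  have hq : 0 < E * (1 + y ^ 2) := by positivity
  have hFle : F y t ≤ F x t := by linarith
  have hdiv : F y t / y ≤ F x t / x :=
    div_le_div₀ (hbd x t hx.le ht.le).1 hFle hx hxy.le
  have hp : pX F y t = -(E * (2 * y)) := by linarith
  have hEy : 0 ≤ E * (2 * y) := by positivity
  have hEK : E * (2 * y) ≤ K := by rw [hp, abs_neg, abs_of_nonneg hEy] at hKy; exact hKy
  have hEq : E * (2 * y) ≤ E * (1 + y ^ 2) := by gcongr; nlinarith [sq_nonneg (y - 1)]
  have hE2 : E ≤ E * (1 + y ^ 2) := by nlinarith [sq_nonneg y]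
  rw [a1] at e1
  rw [hp] at e2
  generalize E * (2 * y) = a at *
  generalize E * (1 + y ^ 2) = q at *
  have hKK : 0 ≤ (K : ℝ) := K.2
  have f1 : ε * pXX F x t ≤ 0 := mul_nonpos_of_nonneg_of_nonpos hε.le a2
  have f2 : ε * (-pXX F y t) ≤ ε * (2 * q) := by gcongr; linarith
  have f3 : a * (a + 2 * m + 1) ≤ q * (K + 2 * m + 1) := by gcongr
  have f4 : 0 < q * (K + 2 * m + 1) := by positivity
  subst hlam
  linarith

/-- The solution stays `m`-Lipschitz from above in `x`, up to an arbitrarily small quadratic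
error. -/
theorem sub_le_add_error_of_viscous {ε m δ lam : ℝ} (hε : 0 < ε) (hm₀ : 0 < m) (hδ : 0 < δ)
    {F : ℝ → ℝ → ℝ}
    (hcont : ContinuousOn (fun p : ℝ × ℝ => F p.1 p.2) (Ici 0 ×ˢ Ici 0))
    (hx_reg : ∀ t : ℝ, 0 < t → ContDiffOn ℝ 2 (fun x => F x t) (Ici 0))
    (ht_reg : ∀ x : ℝ, 0 ≤ x → ContDiffOn ℝ 1 (fun s => F x s) (Ioi 0))
    (hbd : ∀ x t : ℝ, 0 ≤ x → 0 ≤ t → 0 ≤ F x t ∧ F x t ≤ m * x)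
    (hPDE : ∀ x t : ℝ, 0 < x → 0 < t →
      pT F x t + (1 / 2) * (pX F x t - m) * (pX F x t - m - 1) + F x t / x - m =
        ε * pXX F x t)
    (hmono : MonotoneOn (fun x => m * x - F x 0) (Ici 0))
    (hlam : lam = 1 + 2 * ε)
    {x y t : ℝ} (hx : 0 ≤ x) (hxy : x ≤ y) (ht : 0 ≤ t) :
    (m * x - F x t) - (m * y - F y t) ≤ δ * Real.exp (lam * t) * (1 + y ^ 2) := by
  have hlam0 : 0 < lam := by rw [hlam]; positivity
  by_contra! hcon
  obtain ⟨x, y, t, hx, hxy, ht, hval, hA, hB, hT⟩ := exists_interior_max_of_pos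
    (A := fun x t => m * x - F x t)
    (B := fun y t => F y t - m * y - δ * Real.exp (lam * t) * (1 + y ^ 2)) (R := m / δ)
    (by fun_prop) (by fun_prop)
    (fun y t hy ht => by
      have h1 := hbd 0 t le_rfl ht
      have h2 := hbd y t hy ht
      have : 0 ≤ δ * Real.exp (lam * t) * (1 + y ^ 2) := by positivity
      linarith)
    (fun x t hx ht => by
      have : 0 ≤ δ * Real.exp (lam * t) * (1 + x ^ 2) := by positivity
      linarith)
    (fun x y hx hxy => by
      have h1 : m * x - F x 0 ≤ m * y - F y 0 := hmono hx (hx.trans hxy) hxy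
      have : 0 ≤ δ * Real.exp (lam * 0) * (1 + y ^ 2) := by positivity
      linarith)
    (fun x y t hx hxy hy ht => by
      have h1 := hbd x t hx ht
      have h2 := hbd y t (hx.trans hxy) ht
      have h3 : m ≤ y * δ := (div_le_iff₀ hδ).1 hy
      have h4 : δ * 1 * (1 + y ^ 2) ≤ δ * Real.exp (lam * t) * (1 + y ^ 2) := by
        gcongr
        exact Real.one_le_exp (by positivity)
      have hy0 := hx.trans hxy
      nlinarith)
    (x₀ := x) (y₀ := y) (T := t) hx hxy ht (by linarith)
  have hy := hx.trans hxy
  set E := δ * Real.exp (lam * t) with hE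
  have hEpos : 0 < E := by positivity
  have hxr := hx_reg t ht
  obtain ⟨a1, a2⟩ := hA.hasDerivAt_eq_zero_and_nonpos
    (f' := fun z => m - pX F z t) (f'' := -pXX F x t)
    ((eventually_gt_nhds hx).mono fun z hz => by
      simpa using ((hasDerivAt_id' z).const_mul m).fun_sub (hasDerivAt_pX hxr hz))
    ((hasDerivAt_pXX hxr hx).const_sub m)
  obtain ⟨b1, b2⟩ := hB.hasDerivAt_eq_zero_and_nonpos
    (f' := fun z => pX F z t - m - E * (2 * z)) (f'' := pXX F y t - E * 2)
    ((eventually_gt_nhds hy).mono fun z hz => by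
      have := ((hasDerivAt_pow 2 z).const_add 1).const_mul E
      simpa using ((hasDerivAt_pX hxr hz).fun_sub ((hasDerivAt_id' z).const_mul m)).fun_sub this)
    (by
      have := ((hasDerivAt_id' y).const_mul 2).const_mul E
      simpa using ((hasDerivAt_pXX hxr hy).sub_const m).fun_sub this)
  have hexp : HasDerivAt (fun s => δ * Real.exp (lam * s) * (1 + y ^ 2))
      (lam * (E * (1 + y ^ 2))) t :=
    (((((hasDerivAt_id' t).const_mul lam).exp).const_mul δ).mul_const (1 + y ^ 2)).congr_deriv
      (by rw [hE]; ring)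
  have c := (((hasDerivAt_pT (ht_reg x hx.le) ht).const_sub (m * x)).fun_add
    (((hasDerivAt_pT (ht_reg y hy.le) ht).sub_const (m * y)).fun_sub
      hexp)).nonneg_of_eventually_le_left hT
  have e1 := hPDE x t hx ht
  have e2 := hPDE y t hy ht
  have hq : 0 < E * (1 + y ^ 2) := by positivity
  have hFle : F x t + m * (y - x) ≤ F y t := by linarith
  have hdiv : F x t / x ≤ F y t / y := by
    rw [div_le_div_iff₀ hx hy]
    nlinarith [(hbd x t hx.le ht.le).2, mul_le_mul_of_nonneg_left hFle hx.le,
      mul_le_mul_of_nonneg_right (hbd x t hx.le ht.le).2 (sub_nonneg.2 hxy.le)]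
  have hp : pX F y t = m + E * (2 * y) := by linarith
  have hp' : pX F x t = m := by linarith
  have hEy : 0 ≤ E * (2 * y) := by positivity
  have hEq : E * (2 * y) ≤ E * (1 + y ^ 2) := by gcongr; nlinarith [sq_nonneg (y - 1)]
  have hE2 : E ≤ E * (1 + y ^ 2) := by nlinarith [sq_nonneg y]
  rw [hp'] at e1
  rw [hp] at e2
  generalize E * (2 * y) = a at *
  generalize E * (1 + y ^ 2) = q at *
  have f1 : ε * (-pXX F x t) ≤ 0 := mul_nonpos_of_nonneg_of_nonpos hε.le a2
  have f2 : ε * pXX F y t ≤ ε * (2 * q) := by gcongr; linarith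
  subst hlam
  linarith [sq_nonneg a]

/-- An inequality that holds up to arbitrarily small multiples of a constant holds exactly. -/
theorem nonpos_of_forall_le_mul {a c : ℝ} (h : ∀ δ > 0, a ≤ δ * c) : a ≤ 0 := by
  have h1 : Tendsto (fun δ : ℝ => δ * c) (nhdsWithin 0 (Ioi 0)) (nhds 0) := by
    have : Tendsto (fun δ : ℝ => δ * c) (nhds 0) (nhds (0 * c)) :=
      (continuous_id.mul continuous_const).tendsto 0
    simpa using this.mono_left nhdsWithin_le_nhds
  exact ge_of_tendsto h1 (eventually_mem_nhdsWithin.mono fun δ hδ => h δ hδ)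

/-- Lemma 3.1, gradient bound for the viscous approximation with `a ≡ 1`.
Let `ε > 0`, `0 < m ≤ 1`, `F₀ ∈ C²` Lipschitz, sublinear, `0 ≤ F₀ ≤ m·x`, satisfying (A1),(A2).
If `F` is a classical solution of
`∂ₜF + (1/2)(∂ₓF − m)(∂ₓF − m − 1) + F/x − m = ε·∂ₓ²F` on `(0,∞)×(0,∞)`,
continuous up to the boundary, `C²` in `x` and `C¹` in `t` up to `x = 0` for `t > 0`,
globally Lipschitz in `x`, with `0 ≤ F ≤ m·x`, `F(·,0) = F₀`, `F(0,·) = 0`,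
then `0 ≤ ∂ₓF ≤ m` on `[0,∞)×(0,∞)`. -/
theorem gradient_bound_viscous (ε m : ℝ) (hε : 0 < ε) (hm₀ : 0 < m) (hm₁ : m ≤ 1)
    (F₀ : ℝ → ℝ) (hC2 : ContDiffOn ℝ 2 F₀ (Ici 0))
    (hF₀Lip : ∃ K : NNReal, LipschitzOnWith K F₀ (Ici 0))
    (hF₀Sub : Sublinear F₀)
    (hF₀Bd : ∀ x : ℝ, 0 ≤ x → 0 ≤ F₀ x ∧ F₀ x ≤ m * x)
    (hA1 : (∀ x : ℝ, 0 ≤ x → 0 ≤ D1 F₀ x ∧ D1 F₀ x ≤ m) ∧ D1 F₀ 0 = m)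
    (hA2 : ∃ C > 0, ∀ x : ℝ, 0 < x → -C ≤ D2 F₀ x ∧ D2 F₀ x ≤ 0)
    (F : ℝ → ℝ → ℝ)
    (hcont : ContinuousOn (fun p : ℝ × ℝ => F p.1 p.2) (Ici 0 ×ˢ Ici 0))
    (hsmooth : ContDiffOn ℝ (⊤ : ℕ∞) (fun p : ℝ × ℝ => F p.1 p.2) (Ioi 0 ×ˢ Ioi 0))
    (hx_reg : ∀ t : ℝ, 0 < t → ContDiffOn ℝ 2 (fun x => F x t) (Ici 0))
    (ht_reg : ∀ x : ℝ, 0 ≤ x → ContDiffOn ℝ 1 (fun s => F x s) (Ioi 0))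
    (hLipx : ∃ K : NNReal, ∀ t : ℝ, 0 ≤ t → LipschitzOnWith K (fun x => F x t) (Ici 0))
    (hbd : ∀ x t : ℝ, 0 ≤ x → 0 ≤ t → 0 ≤ F x t ∧ F x t ≤ m * x)
    (hPDE : ∀ x t : ℝ, 0 < x → 0 < t →
      pT F x t + (1 / 2) * (pX F x t - m) * (pX F x t - m - 1) + F x t / x - m =
        ε * pXX F x t)
    (hinit : ∀ x : ℝ, 0 ≤ x → F x 0 = F₀ x)
    (hbdry : ∀ t : ℝ, 0 ≤ t → F 0 t = 0) :
    ∀ x t : ℝ, 0 ≤ x → 0 < t → 0 ≤ pX F x t ∧ pX F x t ≤ m := by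
  obtain ⟨K, hK⟩ := hLipx
  have hdiff : DifferentiableOn ℝ F₀ (Ici 0) := hC2.differentiableOn (by norm_num)
  have hder : ∀ x ∈ interior (Ici (0 : ℝ)), HasDerivAt F₀ (D1 F₀ x) x := by
    intro x hx
    rw [interior_Ici, mem_Ioi] at hx
    exact (hdiff x hx.le).hasDerivWithinAt.hasDerivAt (Ici_mem_nhds hx)
  have hmono : MonotoneOn (fun x => F x 0) (Ici 0) := by
    refine MonotoneOn.congr (f₁ := F₀) ?_ fun x hx => (hinit x hx).symm
    refine monotoneOn_of_deriv_nonneg (convex_Ici 0) hdiff.continuousOn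
      (hdiff.mono interior_subset) fun x hx => ?_
    rw [(hder x hx).deriv]
    exact (hA1.1 x (interior_subset hx)).1
  have hmono' : MonotoneOn (fun x => m * x - F x 0) (Ici 0) := by
    refine MonotoneOn.congr (f₁ := fun x => m * x - F₀ x) ?_ fun x hx => by
      simp only [hinit x hx]
    have hd : ∀ x ∈ interior (Ici (0 : ℝ)),
        HasDerivAt (fun x => m * x - F₀ x) (m - D1 F₀ x) x := fun x hx => by
      simpa using ((hasDerivAt_id' x).const_mul m).fun_sub (hder x hx)
    refine monotoneOn_of_deriv_nonneg (convex_Ici 0)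
      ((continuous_const.mul continuous_id).continuousOn.sub hdiff.continuousOn)
      (fun x hx => (hd x hx).differentiableAt.differentiableWithinAt) fun x hx => ?_
    rw [(hd x hx).deriv]
    linarith [(hA1.1 x (interior_subset hx)).2]
  intro x t hx ht
  have hlow : MonotoneOn (fun z => F z t) (Ici 0) := by
    intro a ha b hb hab
    refine sub_nonpos.1 (nonpos_of_forall_le_mul
      (c := Real.exp ((K + 2 * m + 1 + 2 * ε) * t) * (1 + b ^ 2)) fun δ hδ => ?_)
    rw [← mul_assoc]
    exact sub_le_error_of_viscous hε hm₀ hδ hcont hx_reg ht_reg hK hbd hPDE hmono rfl ha hab ht.le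
  have hup : MonotoneOn (fun z => m * z - F z t) (Ici 0) := by
    intro a ha b hb hab
    refine sub_nonpos.1 (nonpos_of_forall_le_mul
      (c := Real.exp ((1 + 2 * ε) * t) * (1 + b ^ 2)) fun δ hδ => ?_)
    rw [← mul_assoc]
    exact sub_le_add_error_of_viscous hε hm₀ hδ hcont hx_reg ht_reg hbd hPDE hmono' rfl ha hab ht.le
  refine ⟨hlow.derivWithin_nonneg, ?_⟩
  have hd : HasDerivWithinAt (fun z => m * z - F z t) (m - pX F x t) (Ici 0) x := by
    simpa [pX] using ((hasDerivWithinAt_id x (Ici 0)).const_mul m).fun_sub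
      (((hx_reg t ht).differentiableOn (by norm_num) x hx).hasDerivWithinAt)
  have := hup.derivWithin_nonneg (x := x)
  rw [hd.derivWithin (uniqueDiffOn_Ici 0 x hx)] at this
  linarith
end
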